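/- For every positive integer n with n ∉ {1, 2, 11, 29, 47, 56, 67, 79, 104, 121, 134, 191}, there exists no almost perfect linear Lee code of packing radius 2 in ℤⁿ. -/

import Mathlib

/-- The Lee sphere of radius 2 in `ℤⁿ`: `S(n,2) = {x ∈ ℤⁿ : Σᵢ |xᵢ| ≤ 2}`. -/
def LeeSphere2 (n : ℕ) : Set (Fin n → ℤ) := {x | (∑ i, |x i|) ≤ 2}

/-- An almost perfect linear Lee (APLL) code of packing radius 2 in `ℤⁿ`:
a subgroup `C` of `ℤⁿ` of index `2n²+2n+2 = |S(n,2)|+1` such that the translates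
`S(n,2)+c`, `c ∈ C`, are pairwise disjoint. -/
def IsAPLLCode (n : ℕ) (C : AddSubgroup (Fin n → ℤ)) : Prop :=
  C.index = 2 * n ^ 2 + 2 * n + 2 ∧
  ∀ c₁ ∈ C, ∀ c₂ ∈ C, c₁ ≠ c₂ →
    Disjoint ((fun x => x + c₁) '' LeeSphere2 n) ((fun x => x + c₂) '' LeeSphere2 n)

namespace APLL
open Finset AddMonoidAlgebra

/-- The integral group ring of an additive commutative group. -/
abbrev GroupRing (G : Type*) [AddCommGroup G] := AddMonoidAlgebra ℤ G

section GroupRing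

variable {G : Type*} [AddCommGroup G]

/-- The group element `g` seen in the group ring. -/
noncomputable def mono (g : G) : GroupRing G := AddMonoidAlgebra.single g 1

/-- The augmentation map. -/
noncomputable def aug : GroupRing G →+* ℤ :=
  (AddMonoidAlgebra.lift ℤ ℤ G 1 : GroupRing G →ₐ[ℤ] ℤ)

/-- The endomorphism of the group ring induced by multiplication by `k`. -/
noncomputable def psi (k : ℤ) : GroupRing G →+* GroupRing G :=
  AddMonoidAlgebra.mapDomainRingHom ℤ (zsmulAddGroupHom k : G →+ G)

lemma mono_zero : mono (0 : G) = 1 := rfl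

lemma mono_mul_mono (g h : G) : mono g * mono h = mono (g + h) := by
  simp [mono, AddMonoidAlgebra.single_mul_single]

lemma coeff_mono [DecidableEq G] (g h : G) : (mono g).coeff h = if g = h then 1 else 0 := by
  simp [mono, Finsupp.single_apply]

lemma aug_mono (g : G) : aug (mono g) = 1 := by
  simp [aug, mono]

lemma psi_mono (k : ℤ) (g : G) : psi k (mono g) = mono (k • g) := by
  simp [psi, mono]

/-- Additive maps that agree on group elements agree on the group ring. -/
lemma addHom_ext_mono {N : Type*} [AddCommGroup N] {f f' : GroupRing G →+ N}
    (h : ∀ g, f (mono g) = f' (mono g)) : f = f' := by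
  refine AddMonoidAlgebra.addMonoidHom_ext fun g r => ?_
  have : (AddMonoidAlgebra.single g r : GroupRing G) = r • mono g := by
    simp [mono, AddMonoidAlgebra.smul_single]
  rw [this, map_zsmul, map_zsmul, h]

lemma ringHom_eq_of_mono {N : Type*} [CommRing N] {f f' : GroupRing G →+* N}
    (h : ∀ g, f (mono g) = f' (mono g)) (x : GroupRing G) : f x = f' x :=
  DFunLike.congr_fun (addHom_ext_mono (f := f.toAddMonoidHom) (f' := f'.toAddMonoidHom) h) x

lemma psi_psi (k l : ℤ) (x : GroupRing G) : psi k (psi l x) = psi (k * l) x :=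
  ringHom_eq_of_mono (f := (psi k).comp (psi l)) (f' := psi (k * l))
    (fun g => by simp [psi_mono, mul_smul]) x

lemma aug_psi (k : ℤ) (x : GroupRing G) : aug (psi k x) = aug x :=
  ringHom_eq_of_mono (f := aug.comp (psi k)) (f' := aug)
    (fun g => by simp [psi_mono, aug_mono]) x

lemma coeff_int_mul (c : ℤ) (x : GroupRing G) (g : G) :
    ((c : GroupRing G) * x).coeff g = c * x.coeff g := by
  rw [← zsmul_eq_mul, AddMonoidAlgebra.coeff_smul_apply, smul_eq_mul]

lemma coeff_nat_mul (c : ℕ) (x : GroupRing G) (g : G) :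
    ((c : GroupRing G) * x).coeff g = c * x.coeff g := by
  rw [← nsmul_eq_mul, AddMonoidAlgebra.coeff_smul_apply, nsmul_eq_mul]

/-- The coefficientwise Frobenius congruence `x ^ p ≡ ψ_p x (mod p)`. -/
lemma coeff_pow_prime_modEq (p : ℕ) [hp : Fact p.Prime] (x : GroupRing G) (g : G) :
    (x ^ p).coeff g ≡ (psi p x).coeff g [ZMOD p] := by
  let R := AddMonoidAlgebra.mapRingHom G (Int.castRingHom (ZMod p))
  have key : ∀ x : GroupRing G, R x ^ p = R (psi p x) := by
    intro x
    have : CharP (AddMonoidAlgebra (ZMod p) G) p := by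
      refine charP_of_injective_ringHom
        (f := AddMonoidAlgebra.singleZeroRingHom (R := ZMod p) (M := G)) ?_ p
      intro a b h
      exact AddMonoidAlgebra.single_right_injective h
    refine ringHom_eq_of_mono (f := (frobenius _ p).comp R) (f' := R.comp (psi p)) (fun g => ?_) x
    rw [RingHom.comp_apply, RingHom.comp_apply, psi_mono, frobenius_def]
    simp [R, mono, AddMonoidAlgebra.single_pow]
  have h := congrArg (fun y => y.coeff g) (key x)
  rw [← map_pow] at h
  rw [← ZMod.intCast_eq_intCast_iff]
  simpa [R, -map_pow] using h

variable [Fintype G]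

/-- The sum of all group elements. -/
noncomputable def total (G : Type*) [AddCommGroup G] [Fintype G] : GroupRing G := ∑ g : G, mono g

lemma coeff_total (g : G) : (total G).coeff g = 1 := by
  classical
  simp [total, AddMonoidAlgebra.coeff_sum, Finsupp.finsetSum_apply, coeff_mono]

lemma aug_total : aug (total G) = Fintype.card G := by
  simp [total, aug_mono]

lemma eq_sum_mono (x : GroupRing G) : x = ∑ g, (x.coeff g : GroupRing G) * mono g := by
  classical
  ext h
  simp [AddMonoidAlgebra.coeff_sum, Finsupp.finsetSum_apply, coeff_int_mul, coeff_mono]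

lemma aug_eq_sum (x : GroupRing G) : aug x = ∑ g, x.coeff g := by
  conv_lhs => rw [eq_sum_mono x]
  simp [aug_mono]

lemma mono_mul_total (g : G) : mono g * total G = total G := by
  rw [total, mul_sum]
  simp_rw [mono_mul_mono]
  exact Fintype.sum_equiv (Equiv.addLeft g) _ _ (fun _ => rfl)

lemma mul_total (x : GroupRing G) : x * total G = (aug x : GroupRing G) * total G := by
  conv_lhs => rw [eq_sum_mono x]
  rw [sum_mul, aug_eq_sum]
  simp_rw [mul_assoc, mono_mul_total]
  rw [← sum_mul]; push_cast; rfl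

lemma coeff_mul_apply (x y : GroupRing G) (g : G) :
    (x * y).coeff g = ∑ h, x.coeff h * y.coeff (g - h) := by
  classical
  conv_lhs => rw [eq_sum_mono x]
  rw [sum_mul, AddMonoidAlgebra.coeff_sum, Finsupp.finsetSum_apply]
  refine sum_congr rfl fun h _ => ?_
  rw [mul_assoc, coeff_int_mul]
  congr 1
  conv_lhs => rw [eq_sum_mono y]
  rw [mul_sum, AddMonoidAlgebra.coeff_sum, Finsupp.finsetSum_apply]
  rw [sum_eq_single (g - h)]
  · rw [mul_left_comm, coeff_int_mul, mono_mul_mono, coeff_mono]; simp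
  · intro b _ hb
    rw [mul_left_comm, coeff_int_mul, mono_mul_mono, coeff_mono, if_neg, mul_zero]
    rintro rfl; simp at hb
  · simp

lemma zsmul_injective_of_coprime {k : ℤ} (hk : IsCoprime k (Fintype.card G : ℤ)) :
    Function.Injective (fun g : G => k • g) := by
  obtain ⟨u, v, huv⟩ := hk
  intro a b hab
  have h : ∀ g : G, g = u • k • g := fun g => by
    have : (u * k + v * (Fintype.card G : ℤ)) • g = g := by rw [huv, one_smul]
    rw [add_smul, mul_smul v, natCast_zsmul, card_nsmul_eq_zero, smul_zero, add_zero,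
      mul_smul] at this
    exact this.symm
  rw [h a, h b]; exact congrArg (u • ·) hab

lemma coeff_psi_smul {k : ℤ} (hk : IsCoprime k (Fintype.card G : ℤ)) (x : GroupRing G) (g : G) :
    (psi k x).coeff (k • g) = x.coeff g := by
  classical
  conv_lhs => rw [eq_sum_mono x]
  simp only [map_sum, map_mul, map_intCast, psi_mono, AddMonoidAlgebra.coeff_sum,
    Finsupp.finsetSum_apply, coeff_int_mul, coeff_mono]
  rw [sum_eq_single g]
  · simp
  · intro b _ hb
    rw [if_neg, mul_zero]
    exact fun h => hb (zsmul_injective_of_coprime hk h)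
  · simp

lemma exists_smul_eq {k : ℤ} (hk : IsCoprime k (Fintype.card G : ℤ)) (g : G) : ∃ h, k • h = g :=
  (Finite.injective_iff_surjective.mp (zsmul_injective_of_coprime hk)) g

lemma psi_total {k : ℤ} (hk : IsCoprime k (Fintype.card G : ℤ)) : psi k (total G) = total G := by
  ext g
  obtain ⟨h, rfl⟩ := exists_smul_eq hk g
  rw [coeff_psi_smul hk, coeff_total, coeff_total]

lemma coeff_neg_of_psi {x : GroupRing G} (hx : psi (-1) x = x) (g : G) :
    x.coeff (-g) = x.coeff g := by
  have h := coeff_psi_smul (k := -1) (isCoprime_one_left.neg_left) x g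
  rwa [hx, neg_one_zsmul] at h

/-- The inner product of coefficient vectors as a coefficient of a product. -/
lemma sum_coeff_mul_coeff (x : GroupRing G) {y : GroupRing G} (hy : psi (-1) y = y) :
    ∑ g, x.coeff g * y.coeff g = (x * y).coeff 0 := by
  rw [coeff_mul_apply]
  exact sum_congr rfl fun g _ => by rw [zero_sub, coeff_neg_of_psi hy]

lemma coeff_mul_nonneg {x y : GroupRing G} (hx : ∀ g, 0 ≤ x.coeff g) (hy : ∀ g, 0 ≤ y.coeff g)
    (g : G) : 0 ≤ (x * y).coeff g := by
  rw [coeff_mul_apply]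
  exact sum_nonneg fun h _ => mul_nonneg (hx _) (hy _)

end GroupRing

section SplitPair

variable {G : Type*} [AddCommGroup G] [Fintype G]

/-- A near-factorization `p * q = G - 1` of a group of order `n ^ 2 + n + 1` into symmetric
subsets of sizes `n` and `n + 1` that arises from an almost perfect linear Lee code. -/
structure SplitPair (n : ℕ) (p q : GroupRing G) : Prop where
  card : Fintype.card G = n ^ 2 + n + 1
  mul_eq : p * q = total G - 1
  sq_eq : p ^ 2 + q ^ 2 + psi 2 (p + q) = 2 * total G + 2 * (n : GroupRing G)
  aug_left : aug p = n
  aug_right : aug q = n + 1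
  nonneg_left : ∀ g, 0 ≤ p.coeff g
  nonneg_right : ∀ g, 0 ≤ q.coeff g
  symm_left : psi (-1) p = p
  symm_right : psi (-1) q = q
  one_le : 1 ≤ (p + q).coeff 0

namespace SplitPair

variable {n : ℕ} {p q : GroupRing G} (h : SplitPair n p q)
include h

lemma isCoprime_two : IsCoprime (2 : ℤ) (Fintype.card G : ℤ) := by
  rw [h.card]
  have h2 : Odd (n ^ 2 + n + 1) := by
    rcases Nat.even_or_odd n with ⟨k, hk⟩ | ⟨k, hk⟩ <;> subst hk
    · exact ⟨2 * k ^ 2 + k, by ring⟩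
    · exact ⟨2 * k ^ 2 + 3 * k + 1, by ring⟩
  rw [Int.isCoprime_iff_gcd_eq_one]
  exact_mod_cast (Nat.coprime_two_left.mpr h2)

lemma isCoprime_four : IsCoprime (4 : ℤ) (Fintype.card G : ℤ) := by
  have := h.isCoprime_two.mul_left h.isCoprime_two
  norm_num at this; exact this

lemma isCoprime_three (hn : n % 3 ≠ 1) : IsCoprime (3 : ℤ) (Fintype.card G : ℤ) := by
  rw [h.card, Int.isCoprime_iff_gcd_eq_one]
  have : Nat.Coprime 3 (n ^ 2 + n + 1) := by
    rw [Nat.Prime.coprime_iff_not_dvd Nat.prime_three]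
    intro hd
    have : (n ^ 2 + n + 1) % 3 = 0 := Nat.mod_eq_zero_of_dvd hd
    have h3 : n % 3 = 0 ∨ n % 3 = 1 ∨ n % 3 = 2 := by omega
    rcases h3 with h3 | h3 | h3 <;> simp [Nat.add_mod, Nat.pow_mod, h3] at this hn
  exact_mod_cast this

lemma isCoprime_five : IsCoprime (5 : ℤ) (Fintype.card G : ℤ) := by
  rw [h.card, Int.isCoprime_iff_gcd_eq_one]
  have : Nat.Coprime 5 (n ^ 2 + n + 1) := by
    rw [Nat.Prime.coprime_iff_not_dvd Nat.prime_five]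
    intro hd
    have : (n ^ 2 + n + 1) % 5 = 0 := Nat.mod_eq_zero_of_dvd hd
    have h3 : n % 5 = 0 ∨ n % 5 = 1 ∨ n % 5 = 2 ∨ n % 5 = 3 ∨ n % 5 = 4 := by omega
    rcases h3 with h3 | h3 | h3 | h3 | h3 <;> simp [Nat.add_mod, Nat.pow_mod, h3] at this
  exact_mod_cast this

lemma left_mul_total : p * total G = n * total G := by
  rw [mul_total, h.aug_left]; simp

lemma right_mul_total : q * total G = (n + 1) * total G := by
  rw [mul_total, h.aug_right]; simp

lemma aug_psi_add (k : ℤ) : aug (psi k (p + q)) = 2 * n + 1 := by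
  rw [aug_psi, map_add, h.aug_left, h.aug_right]; ring

lemma psi_mul_total (k : ℤ) : psi k (p + q) * total G = (2 * n + 1) * total G := by
  rw [mul_total, h.aug_psi_add]; simp

lemma psi_two_sq : psi 2 (p + q) ^ 2 =
    4 * total G + 2 * (n : GroupRing G) - 2 - psi 4 (p + q) := by
  have h1 := congrArg (psi 2) h.sq_eq
  have h2 := congrArg (psi 2) h.mul_eq
  simp only [map_add, map_mul, map_pow, map_sub, map_one, map_ofNat, map_natCast, psi_psi,
    psi_total h.isCoprime_two] at h1 h2 ⊢
  norm_num at h1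
  linear_combination h1 + 2 * h2

lemma left_mul_psi_two : p * psi 2 (p + q) =
    2 * (n : GroupRing G) * p + ((n : GroupRing G) - 1) * total G + q - p ^ 3 := by
  linear_combination p * h.sq_eq - q * h.mul_eq + 2 * h.left_mul_total - h.right_mul_total

lemma right_mul_psi_two : q * psi 2 (p + q) =
    2 * (n : GroupRing G) * q + ((n : GroupRing G) + 2) * total G + p - q ^ 3 := by
  linear_combination q * h.sq_eq - p * h.mul_eq + 2 * h.right_mul_total - h.left_mul_total

lemma right_mul_psi_four : q * psi 4 (p + q) =
    -4 * (n : GroupRing G) * (q * psi 2 (p + q)) - p * psi 2 (p + q)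
      + (4 * (n : GroupRing G) + 3 + (n + 2) * (n + 1) ^ 2) * total G
      + (4 * (n : GroupRing G) ^ 2 + 2 * n - 3) * q + 2 * n * p - q ^ 5 := by
  have hY := h.right_mul_psi_two
  have hX := h.left_mul_psi_two
  have hS := h.psi_two_sq
  have hpq := h.mul_eq
  have hq := h.right_mul_total
  have hsU := h.psi_mul_total 2
  generalize psi 2 (p + q) = s at *
  generalize psi 4 (p + q) = s4 at *
  generalize total G = U at *
  linear_combination q * hS - s * hY + q ^ 2 * hY + 2 * n * hY + q * hpq + 5 * hq
    + (n + 2) * (q + (n + 1)) * hq - (n + 2) * hsU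
  
end SplitPair
end SplitPair

section PointwiseFacts

variable {G : Type*} [AddCommGroup G] [Fintype G]

omit [Fintype G] in
lemma coeff_one_zero : ((1 : GroupRing G)).coeff 0 = 1 := by
  simp [AddMonoidAlgebra.one_def]

lemma coeff_psi_zero {k : ℤ} (hk : IsCoprime k (Fintype.card G : ℤ)) (x : GroupRing G) :
    (psi k x).coeff 0 = x.coeff 0 := by
  simpa using coeff_psi_smul hk x 0

namespace SplitPair

variable {n : ℕ} {p q : GroupRing G} (h : SplitPair n p q)
include h

lemma symm_psi_add (k : ℤ) : psi (-1) (psi k (p + q)) = psi k (p + q) := by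
  rw [psi_psi, mul_comm, ← psi_psi, map_add, h.symm_left, h.symm_right]

lemma symm_left_mul (k : ℤ) : psi (-1) (p * psi k (p + q)) = p * psi k (p + q) := by
  rw [map_mul, h.symm_left, h.symm_psi_add]

lemma symm_right_mul (k : ℤ) : psi (-1) (q * psi k (p + q)) = q * psi k (p + q) := by
  rw [map_mul, h.symm_right, h.symm_psi_add]

lemma add_sq : (p + q) ^ 2 = 4 * total G + 2 * (n : GroupRing G) - 2 - psi 2 (p + q) := by
  linear_combination h.sq_eq + 2 * h.mul_eq

lemma coeff_add_le_one_and_zero : (∀ g, (p + q).coeff g ≤ 1) ∧ (p + q).coeff 0 = 1 := by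
  have hs : psi (-1) (p + q) = p + q := by rw [map_add, h.symm_left, h.symm_right]
  have h1 := sum_coeff_mul_coeff (p + q) hs
  have h2 : ∑ g, (p + q).coeff g = 2 * n + 1 := by
    rw [← aug_eq_sum, map_add, h.aug_left, h.aug_right]; ring
  have h3 : ((p + q) * (p + q)).coeff 0 = 2 * n + 2 - (p + q).coeff 0 := by
    have e : (p + q) * (p + q) + psi 2 (p + q) + (2 : ℕ) * 1
        = (4 : ℕ) * total G + ((2 * n : ℕ) : GroupRing G) * 1 := by
      push_cast; linear_combination h.add_sq
    have e' := congrArg (fun x => x.coeff 0) e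
    simp only [AddMonoidAlgebra.coeff_add, Finsupp.add_apply, coeff_nat_mul, coeff_total,
      coeff_one_zero, coeff_psi_zero h.isCoprime_two] at e'
    push_cast at e'
    simp only [AddMonoidAlgebra.coeff_add, Finsupp.add_apply]
    linarith
  have h4 : ∀ g, 0 ≤ (p + q).coeff g * (p + q).coeff g - (p + q).coeff g := fun g => by
    have : 0 ≤ (p + q).coeff g := by
      simpa using add_nonneg (h.nonneg_left g) (h.nonneg_right g)
    nlinarith [mul_self_nonneg ((p + q).coeff g), this, mul_nonneg this this]
  have h5 : ∑ g, ((p + q).coeff g * (p + q).coeff g - (p + q).coeff g) = 1 - (p + q).coeff 0 := by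
    rw [sum_sub_distrib, h1, h2, h3]; ring
  have h6 := h.one_le
  have h7 := sum_nonneg (fun g (_ : g ∈ univ) => h4 g)
  have h8 : (p + q).coeff 0 = 1 := by linarith
  refine ⟨fun g => ?_, h8⟩
  have h9 := (sum_eq_zero_iff_of_nonneg (fun g (_ : g ∈ univ) => h4 g)).mp (by rw [h5, h8]; rfl)
    g (mem_univ g)
  nlinarith

lemma coeff_zero : (p + q).coeff 0 = 1 := h.coeff_add_le_one_and_zero.2

lemma coeff_add_le (g : G) : p.coeff g + q.coeff g ≤ 1 := by
  simpa using h.coeff_add_le_one_and_zero.1 g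

lemma coeff_psi_left_mem {k : ℤ} (hk : IsCoprime k (Fintype.card G : ℤ)) (g : G) :
    0 ≤ (psi k p).coeff g ∧ (psi k p).coeff g ≤ 1 := by
  obtain ⟨g, rfl⟩ := exists_smul_eq hk g
  rw [coeff_psi_smul hk]
  have := h.nonneg_left g; have := h.nonneg_right g; have := h.coeff_add_le g
  omega

lemma coeff_psi_right_mem {k : ℤ} (hk : IsCoprime k (Fintype.card G : ℤ)) (g : G) :
    0 ≤ (psi k q).coeff g ∧ (psi k q).coeff g ≤ 1 := by
  obtain ⟨g, rfl⟩ := exists_smul_eq hk g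
  rw [coeff_psi_smul hk]
  have := h.nonneg_left g; have := h.nonneg_right g; have := h.coeff_add_le g
  omega

lemma coeff_psi_add_mem {k : ℤ} (hk : IsCoprime k (Fintype.card G : ℤ)) (g : G) :
    0 ≤ (psi k (p + q)).coeff g ∧ (psi k (p + q)).coeff g ≤ 1 := by
  obtain ⟨g, rfl⟩ := exists_smul_eq hk g
  rw [coeff_psi_smul hk]
  have := h.nonneg_left g; have := h.nonneg_right g; have := h.coeff_add_le g
  simp only [AddMonoidAlgebra.coeff_add, Finsupp.add_apply]
  omega

lemma left_mul_nonneg (g : G) : 0 ≤ (p * psi 2 (p + q)).coeff g :=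
  coeff_mul_nonneg h.nonneg_left (fun g => (h.coeff_psi_add_mem h.isCoprime_two g).1) g

lemma right_mul_nonneg (g : G) : 0 ≤ (q * psi 2 (p + q)).coeff g :=
  coeff_mul_nonneg h.nonneg_right (fun g => (h.coeff_psi_add_mem h.isCoprime_two g).1) g

lemma right_mul_four_mem (g : G) :
    0 ≤ (q * psi 4 (p + q)).coeff g ∧ (q * psi 4 (p + q)).coeff g ≤ n + 1 := by
  refine ⟨coeff_mul_nonneg h.nonneg_right
    (fun g => (h.coeff_psi_add_mem h.isCoprime_four g).1) g, ?_⟩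
  rw [coeff_mul_apply, ← h.aug_right, aug_eq_sum]
  refine sum_le_sum fun x _ => ?_
  have := (h.coeff_psi_add_mem h.isCoprime_four (g - x)).2
  nlinarith [h.nonneg_right x]

lemma sum_left : ∑ g, p.coeff g = n := by rw [← aug_eq_sum, h.aug_left]

lemma sum_right : ∑ g, q.coeff g = n + 1 := by rw [← aug_eq_sum, h.aug_right]

lemma sum_psi_left (k : ℤ) : ∑ g, (psi k p).coeff g = n := by
  rw [← aug_eq_sum, aug_psi, h.aug_left]

lemma sum_psi_right (k : ℤ) : ∑ g, (psi k q).coeff g = n + 1 := by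
  rw [← aug_eq_sum, aug_psi, h.aug_right]

lemma sum_left_mul (k : ℤ) : ∑ g, (p * psi k (p + q)).coeff g = n * (2 * n + 1) := by
  rw [← aug_eq_sum, map_mul, h.aug_psi_add, h.aug_left]

lemma sum_right_mul (k : ℤ) : ∑ g, (q * psi k (p + q)).coeff g = (n + 1) * (2 * n + 1) := by
  rw [← aug_eq_sum, map_mul, h.aug_psi_add, h.aug_right]

lemma coeff_psi_four_mul_zero :
    (psi 2 (p + q) * psi 4 (p + q)).coeff 0 = ((p + q) * psi 2 (p + q)).coeff 0 := by
  have : psi 2 (p + q) * psi 4 (p + q) = psi 2 ((p + q) * psi 2 (p + q)) := by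
    rw [map_mul, psi_psi]; norm_num
  rw [this, coeff_psi_zero h.isCoprime_two]

lemma coeff_psi_two_sq_zero : (psi 2 (p + q) ^ 2).coeff 0 = 2 * n + 1 := by
  have e : psi 2 (p + q) ^ 2 + psi 4 (p + q) + (2 : ℕ) * 1
      = (4 : ℕ) * total G + ((2 * n : ℕ) : GroupRing G) * 1 := by
    push_cast; linear_combination h.psi_two_sq
  have e' := congrArg (fun x => x.coeff 0) e
  simp only [AddMonoidAlgebra.coeff_add, Finsupp.add_apply, coeff_nat_mul, coeff_total,
    coeff_one_zero, coeff_psi_zero h.isCoprime_four] at e'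
  have := h.coeff_zero
  simp only [AddMonoidAlgebra.coeff_add, Finsupp.add_apply] at this
  push_cast at e'
  linarith

lemma sum_sq : ∑ g, ((p * psi 2 (p + q)).coeff g ^ 2 + (q * psi 2 (p + q)).coeff g ^ 2) =
    12 * n ^ 2 + ((p * psi 2 (p + q)).coeff 0 + (q * psi 2 (p + q)).coeff 0) := by
  rw [sum_add_distrib]
  simp_rw [pow_two ((_ : GroupRing G).coeff _)]
  rw [sum_coeff_mul_coeff _ (h.symm_left_mul 2), sum_coeff_mul_coeff _ (h.symm_right_mul 2)]
  have e : p * psi 2 (p + q) * (p * psi 2 (p + q)) + q * psi 2 (p + q) * (q * psi 2 (p + q))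
      + ((2 * n : ℕ) : GroupRing G) * psi 2 (p + q) + (4 * (2 * n + 1) : ℕ) * total G
      = (2 * (2 * n + 1) ^ 2 : ℕ) * total G + (2 * n : ℕ) * (psi 2 (p + q) ^ 2)
      + (2 : ℕ) * psi 2 (p + q) + psi 2 (p + q) * psi 4 (p + q) := by
    push_cast
    linear_combination psi 2 (p + q) ^ 2 * h.sq_eq - psi 2 (p + q) * h.psi_two_sq
      + (2 * psi 2 (p + q) + 2 * (2 * n + 1) - 4) * h.psi_mul_total 2
  have e' := congrArg (fun x => x.coeff 0) e
  simp only [AddMonoidAlgebra.coeff_add, Finsupp.add_apply, coeff_nat_mul, coeff_total,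
    h.coeff_psi_four_mul_zero, h.coeff_psi_two_sq_zero, coeff_psi_zero h.isCoprime_two, add_mul]
    at e' ⊢
  have := h.coeff_zero
  simp only [AddMonoidAlgebra.coeff_add, Finsupp.add_apply] at this
  push_cast at e'
  nlinarith

lemma sum_mul : ∑ g, (p * psi 2 (p + q)).coeff g * (q * psi 2 (p + q)).coeff g =
    (2 * n + 1) ^ 2 - (2 * n + 1) := by
  rw [sum_coeff_mul_coeff _ (h.symm_right_mul 2)]
  have e : p * psi 2 (p + q) * (q * psi 2 (p + q)) + psi 2 (p + q) ^ 2
      = ((2 * n + 1) ^ 2 : ℕ) * total G := by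
    push_cast
    linear_combination psi 2 (p + q) ^ 2 * h.mul_eq
      + (psi 2 (p + q) + (2 * n + 1)) * h.psi_mul_total 2
  have e' := congrArg (fun x => x.coeff 0) e
  simp only [AddMonoidAlgebra.coeff_add, Finsupp.add_apply, coeff_nat_mul, coeff_total,
    h.coeff_psi_two_sq_zero] at e'
  push_cast at e'
  linarith

lemma sum_mul_four : ∑ g, (p * psi 2 (p + q)).coeff g * (q * psi 4 (p + q)).coeff g =
    (2 * n + 1) ^ 2 - ((p * psi 2 (p + q)).coeff 0 + (q * psi 2 (p + q)).coeff 0) := by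
  rw [sum_coeff_mul_coeff _ (h.symm_right_mul 4)]
  have e : p * psi 2 (p + q) * (q * psi 4 (p + q)) + psi 2 (p + q) * psi 4 (p + q)
      = ((2 * n + 1) ^ 2 : ℕ) * total G := by
    push_cast
    linear_combination psi 2 (p + q) * psi 4 (p + q) * h.mul_eq
      + psi 4 (p + q) * h.psi_mul_total 2 + (2 * n + 1) * h.psi_mul_total 4
  have e' := congrArg (fun x => x.coeff 0) e
  simp only [AddMonoidAlgebra.coeff_add, Finsupp.add_apply, coeff_nat_mul, coeff_total,
    h.coeff_psi_four_mul_zero, add_mul] at e'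
  push_cast at e'
  linarith

lemma left_mul_modEq (g : G) : (p * psi 2 (p + q)).coeff g ≡
    2 * n * p.coeff g + (n - 1) + q.coeff g - (psi 3 p).coeff g [ZMOD 3] := by
  have : Fact (Nat.Prime 3) := ⟨Nat.prime_three⟩
  have e : p * psi 2 (p + q) + p ^ 3 + total G
      = ((2 * n : ℕ) : GroupRing G) * p + (n : ℕ) * total G + q := by
    push_cast; linear_combination h.left_mul_psi_two
  have e' := congrArg (fun x => x.coeff g) e
  simp only [AddMonoidAlgebra.coeff_add, Finsupp.add_apply, coeff_nat_mul, coeff_total] at e'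
  have h3 := coeff_pow_prime_modEq 3 p g
  push_cast at h3 e'
  have := h3.symm.add_left ((p * psi 2 (p + q)).coeff g - (psi 3 p).coeff g)
  convert this using 1 <;> linarith

lemma right_mul_modEq (g : G) : (q * psi 2 (p + q)).coeff g ≡
    2 * n * q.coeff g + (n + 2) + p.coeff g - (psi 3 q).coeff g [ZMOD 3] := by
  have : Fact (Nat.Prime 3) := ⟨Nat.prime_three⟩
  have e : q * psi 2 (p + q) + q ^ 3
      = ((2 * n : ℕ) : GroupRing G) * q + (n + 2 : ℕ) * total G + p := by
    push_cast; linear_combination h.right_mul_psi_two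
  have e' := congrArg (fun x => x.coeff g) e
  simp only [AddMonoidAlgebra.coeff_add, Finsupp.add_apply, coeff_nat_mul, coeff_total] at e'
  have h3 := coeff_pow_prime_modEq 3 q g
  push_cast at h3 e'
  have := h3.symm.add_left ((q * psi 2 (p + q)).coeff g - (psi 3 q).coeff g)
  convert this using 1 <;> linarith

lemma right_mul_four_modEq (g : G) : (q * psi 4 (p + q)).coeff g ≡
    -4 * n * (q * psi 2 (p + q)).coeff g - (p * psi 2 (p + q)).coeff g
      + (4 * n + 3 + (n + 2) * (n + 1) ^ 2) + (4 * n ^ 2 + 2 * n - 3) * q.coeff g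
      + 2 * n * p.coeff g - (psi 5 q).coeff g [ZMOD 5] := by
  have : Fact (Nat.Prime 5) := ⟨Nat.prime_five⟩
  have e : q * psi 4 (p + q) + q ^ 5 + (4 * n : ℕ) * (q * psi 2 (p + q)) + p * psi 2 (p + q)
      + (3 : ℕ) * q
      = (4 * n + 3 + (n + 2) * (n + 1) ^ 2 : ℕ) * total G + (4 * n ^ 2 + 2 * n : ℕ) * q
      + (2 * n : ℕ) * p := by
    push_cast; linear_combination h.right_mul_psi_four
  have e' := congrArg (fun x => x.coeff g) e
  simp only [AddMonoidAlgebra.coeff_add, Finsupp.add_apply, coeff_nat_mul, coeff_total] at e'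
  have h3 := coeff_pow_prime_modEq 5 q g
  push_cast at h3 e'
  have := h3.symm.add_left ((q * psi 4 (p + q)).coeff g - (psi 5 q).coeff g)
  convert this using 1 <;> linarith

end SplitPair
end PointwiseFacts

section ResidueZero

variable {G : Type*} [AddCommGroup G] [Fintype G]

lemma coeff_mul_le {x y : GroupRing G} {c d : ℤ} (hx : ∀ g, 0 ≤ x.coeff g)
    (hy : ∀ g, g ≠ 0 → y.coeff g ≤ c) (hy0 : y.coeff 0 ≤ c + d) (g : G) :
    (x * y).coeff g ≤ c * aug x + d * x.coeff g := by
  classical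
  have key : ∀ k, 0 ≤ ((c : GroupRing G) * total G + (d : GroupRing G) * 1 - y).coeff k := by
    intro k
    simp only [AddMonoidAlgebra.coeff_sub, AddMonoidAlgebra.coeff_add, Finsupp.sub_apply,
      Finsupp.add_apply, coeff_int_mul, coeff_total, ← mono_zero, coeff_mono]
    by_cases hk : 0 = k
    · subst hk; simp; linarith
    · simp [hk, hy k (Ne.symm hk)]
  have h := coeff_mul_nonneg hx key g
  have e : x * ((c : GroupRing G) * total G + (d : GroupRing G) * 1 - y) + x * y
      = ((c * aug x : ℤ) : GroupRing G) * total G + (d : GroupRing G) * x := by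
    push_cast; linear_combination (c : GroupRing G) * mul_total x
  have e' := congrArg (fun x => x.coeff g) e
  simp only [AddMonoidAlgebra.coeff_add, Finsupp.add_apply, coeff_int_mul, coeff_total] at e'
  linarith

lemma coeff_zero_mul_coeff_le {x y : GroupRing G} (hx : ∀ g, 0 ≤ x.coeff g)
    (hy : ∀ g, 0 ≤ y.coeff g) (g : G) : x.coeff 0 * y.coeff g ≤ (x * y).coeff g := by
  rw [coeff_mul_apply]
  have := single_le_sum (f := fun k => x.coeff k * y.coeff (g - k))
    (fun k _ => mul_nonneg (hx k) (hy _)) (mem_univ 0)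
  simpa using this

namespace SplitPair

variable {n : ℕ} {p q : GroupRing G} (h : SplitPair n p q)
include h

lemma left_sq_zero : (p ^ 2).coeff 0 = n := by
  rw [pow_two, ← sum_coeff_mul_coeff p h.symm_left, ← h.sum_left]
  refine sum_congr rfl fun g _ => ?_
  have := h.nonneg_left g; have := h.nonneg_right g; have := h.coeff_add_le g
  have : p.coeff g = 0 ∨ p.coeff g = 1 := by omega
  rcases this with e | e <;> simp [e]

lemma right_sq_zero : (q ^ 2).coeff 0 = n + 1 := by
  rw [pow_two, ← sum_coeff_mul_coeff q h.symm_right, ← h.sum_right]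
  refine sum_congr rfl fun g _ => ?_
  have := h.nonneg_left g; have := h.nonneg_right g; have := h.coeff_add_le g
  have : q.coeff g = 0 ∨ q.coeff g = 1 := by omega
  rcases this with e | e <;> simp [e]

lemma sq_add_sq_le {g : G} (hg : g ≠ 0) : (p ^ 2).coeff g + (q ^ 2).coeff g ≤ 2 := by
  classical
  have e : p ^ 2 + q ^ 2 + psi 2 (p + q) = (2 : ℕ) * total G + ((2 * n : ℕ) : GroupRing G) * 1 := by
    push_cast; linear_combination h.sq_eq
  have e' := congrArg (fun x => x.coeff g) e
  simp only [AddMonoidAlgebra.coeff_add, Finsupp.add_apply, coeff_nat_mul, coeff_total,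
    ← mono_zero, coeff_mono, if_neg hg.symm] at e'
  have := (h.coeff_psi_add_mem h.isCoprime_two g).1
  push_cast at e'
  linarith

lemma left_sq_nonneg (g : G) : 0 ≤ (p ^ 2).coeff g := by
  rw [pow_two]; exact coeff_mul_nonneg h.nonneg_left h.nonneg_left g

lemma right_sq_nonneg (g : G) : 0 ≤ (q ^ 2).coeff g := by
  rw [pow_two]; exact coeff_mul_nonneg h.nonneg_right h.nonneg_right g

lemma coeff_mul_left_sq_le {x : GroupRing G} (hx : ∀ g, 0 ≤ x.coeff g) (g : G) :
    (x * p ^ 2).coeff g ≤ 2 * aug x + (n - 2) * x.coeff g :=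
  coeff_mul_le hx (fun g hg => by linarith [h.sq_add_sq_le hg, h.right_sq_nonneg g])
    (by rw [h.left_sq_zero]; linarith) g

lemma coeff_mul_right_sq_le {x : GroupRing G} (hx : ∀ g, 0 ≤ x.coeff g) (g : G) :
    (x * q ^ 2).coeff g ≤ 2 * aug x + (n - 1) * x.coeff g :=
  coeff_mul_le hx (fun g hg => by linarith [h.sq_add_sq_le hg, h.left_sq_nonneg g])
    (by rw [h.right_sq_zero]; linarith) g

lemma excess_left_mem (hn : n % 3 = 0) (hn0 : 2 ≤ n) (g : G) :
    let e := (p * psi 2 (p + q)).coeff g - 2 + 2 * q.coeff g + (psi 3 p).coeff g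
    0 ≤ e ∧ e ≤ 6 := by
  have h3 := h.isCoprime_three (by omega)
  let x := p * psi 2 (p + q) - (2 : ℕ) * total G + (2 : ℕ) * q + psi 3 p
  have hx : ∀ g, x.coeff g
      = (p * psi 2 (p + q)).coeff g - 2 + 2 * q.coeff g + (psi 3 p).coeff g := fun g => by
    simp only [x, AddMonoidAlgebra.coeff_sub, AddMonoidAlgebra.coeff_add, Finsupp.sub_apply,
      Finsupp.add_apply, coeff_nat_mul, coeff_total]
    push_cast; ring
  have hdvd : ∀ g, 3 ∣ x.coeff g := fun g => by
    have h1 := (h.left_mul_modEq g).dvd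
    obtain ⟨m, rfl⟩ : ∃ m, n = 3 * m := ⟨n / 3, by omega⟩
    have h2 : (3 : ℤ) ∣ 2 * ((3 * m : ℕ) : ℤ) * p.coeff g := ⟨2 * m * p.coeff g, by push_cast; ring⟩
    rw [hx]; push_cast at *; omega
  have hpos : ∀ g, 0 ≤ x.coeff g := fun g => by
    have h1 := hdvd g
    have h2 := h.left_mul_nonneg g
    have h4 := h.nonneg_right g
    have h5 := (h.coeff_psi_left_mem h3 g).1
    rw [hx] at *; omega
  rw [← hx]
  refine ⟨hpos g, ?_⟩
  have h1 := coeff_zero_mul_coeff_le h.right_sq_nonneg hpos g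
  rw [h.right_sq_zero] at h1
  have e : q ^ 2 * x + (n + 1 : ℕ) * total G + q * psi 2 (p + q)
      = (2 : ℕ) * (q * q ^ 2) + psi 3 p * q ^ 2 := by
    simp only [x]; push_cast
    linear_combination q * psi 2 (p + q) * h.mul_eq + q * h.psi_mul_total 2 +
      (- 2 * q + (2 * n + 1) - 2 * (n + 1)) * h.right_mul_total
  have e' := congrArg (fun x => x.coeff g) e
  simp only [AddMonoidAlgebra.coeff_add, Finsupp.add_apply, coeff_nat_mul, coeff_total] at e'
  have h4 := h.coeff_mul_right_sq_le h.nonneg_right g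
  have h5 := h.coeff_mul_right_sq_le (fun g => (h.coeff_psi_left_mem h3 g).1) g
  rw [h.aug_right] at h4
  rw [aug_psi, h.aug_left] at h5
  have h6 := (h.coeff_psi_left_mem h3 g).2
  have h7 := h.right_mul_nonneg g
  have h8 : q.coeff g ≤ 1 := by linarith [h.nonneg_left g, h.coeff_add_le g]
  have hn1 : (2 : ℤ) ≤ n := by exact_mod_cast hn0
  push_cast at e'
  have h9 : ((n : ℤ) + 1) * x.coeff g ≤ 8 * n := by nlinarith
  have h10 : x.coeff g < 8 := by nlinarith
  have := hdvd g
  omega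

lemma excess_right_mem (hn : n % 3 = 0) (hn0 : 2 ≤ n) (g : G) :
    let e := (q * psi 2 (p + q)).coeff g - 2 + 2 * p.coeff g + (psi 3 q).coeff g
    0 ≤ e ∧ e ≤ 9 := by
  have h3 := h.isCoprime_three (by omega)
  let x := q * psi 2 (p + q) - (2 : ℕ) * total G + (2 : ℕ) * p + psi 3 q
  have hx : ∀ g, x.coeff g
      = (q * psi 2 (p + q)).coeff g - 2 + 2 * p.coeff g + (psi 3 q).coeff g := fun g => by
    simp only [x, AddMonoidAlgebra.coeff_sub, AddMonoidAlgebra.coeff_add, Finsupp.sub_apply,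
      Finsupp.add_apply, coeff_nat_mul, coeff_total]
    push_cast; ring
  have hdvd : ∀ g, 3 ∣ x.coeff g := fun g => by
    have h1 := (h.right_mul_modEq g).dvd
    obtain ⟨m, rfl⟩ : ∃ m, n = 3 * m := ⟨n / 3, by omega⟩
    have h2 : (3 : ℤ) ∣ 2 * ((3 * m : ℕ) : ℤ) * q.coeff g := ⟨2 * m * q.coeff g, by push_cast; ring⟩
    rw [hx]; push_cast at *; omega
  have hpos : ∀ g, 0 ≤ x.coeff g := fun g => by
    have h1 := hdvd g
    have h2 := h.right_mul_nonneg g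
    have h4 := h.nonneg_left g
    have h5 := (h.coeff_psi_right_mem h3 g).1
    rw [hx] at *; omega
  rw [← hx]
  refine ⟨hpos g, ?_⟩
  have h1 := coeff_zero_mul_coeff_le h.left_sq_nonneg hpos g
  rw [h.left_sq_zero] at h1
  have e : p ^ 2 * x + p * psi 2 (p + q)
      = (n : ℕ) * total G + (2 : ℕ) * (p * p ^ 2) + psi 3 q * p ^ 2 := by
    simp only [x]; push_cast
    linear_combination p * psi 2 (p + q) * h.mul_eq + p * h.psi_mul_total 2 +
      (- 2 * p + (2 * n + 1) - 2 * n) * h.left_mul_total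
  have e' := congrArg (fun x => x.coeff g) e
  simp only [AddMonoidAlgebra.coeff_add, Finsupp.add_apply, coeff_nat_mul, coeff_total] at e'
  have h4 := h.coeff_mul_left_sq_le h.nonneg_left g
  have h5 := h.coeff_mul_left_sq_le (fun g => (h.coeff_psi_right_mem h3 g).1) g
  rw [h.aug_left] at h4
  rw [aug_psi, h.aug_right] at h5
  have h6 := (h.coeff_psi_right_mem h3 g).2
  have h7 := h.left_mul_nonneg g
  have h8 : p.coeff g ≤ 1 := by linarith [h.nonneg_right g, h.coeff_add_le g]
  have hn1 : (2 : ℤ) ≤ n := by exact_mod_cast hn0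
  push_cast at e'
  have h9 : (n : ℤ) * x.coeff g ≤ 10 * n - 4 := by nlinarith
  have h10 : x.coeff g < 10 := by nlinarith
  have := hdvd g
  omega

lemma sum_const (c : ℤ) : ∑ _g : G, c = (n ^ 2 + n + 1) * c := by
  simp [h.card]

/-- There is no split pair when `n` is a multiple of three and large. -/
theorem false_of_mod_three_eq_zero (hn : n % 3 = 0) (hn0 : 17 ≤ n) : False := by
  have h3 := h.isCoprime_three (by omega)
  have hX : ∀ g, ((p * psi 2 (p + q)).coeff g - 2) ^ 2 ≤
      6 * ((p * psi 2 (p + q)).coeff g - 2 + 2 * q.coeff g + (psi 3 p).coeff g)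
        + 4 * q.coeff g + (psi 3 p).coeff g := fun g => by
    have h1 := h.excess_left_mem hn (by omega) g
    have h2 := h.left_mul_nonneg g
    have h4 := h.nonneg_right g
    have h5 := h.coeff_psi_left_mem h3 g
    have h8 : q.coeff g ≤ 1 := by linarith [h.nonneg_left g, h.coeff_add_le g]
    dsimp only at h1
    generalize (p * psi 2 (p + q)).coeff g = X at *
    generalize q.coeff g = a at *
    generalize (psi 3 p).coeff g = b at *
    obtain ⟨h5, h6⟩ := h5
    interval_cases a <;> interval_cases b <;> nlinarith
  have hY : ∀ g, ((q * psi 2 (p + q)).coeff g - 2) ^ 2 ≤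
      9 * ((q * psi 2 (p + q)).coeff g - 2 + 2 * p.coeff g + (psi 3 q).coeff g)
        + 4 * p.coeff g + (psi 3 q).coeff g := fun g => by
    have h1 := h.excess_right_mem hn (by omega) g
    have h2 := h.right_mul_nonneg g
    have h4 := h.nonneg_left g
    have h5 := h.coeff_psi_right_mem h3 g
    have h8 : p.coeff g ≤ 1 := by linarith [h.nonneg_right g, h.coeff_add_le g]
    dsimp only at h1
    generalize (q * psi 2 (p + q)).coeff g = X at *
    generalize p.coeff g = a at *
    generalize (psi 3 q).coeff g = b at *
    obtain ⟨h5, h6⟩ := h5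
    interval_cases a <;> interval_cases b <;> nlinarith
  have hsum := sum_le_sum fun g (_ : g ∈ univ) => add_le_add (hX g) (hY g)
  have e1 : ∀ g, ((p * psi 2 (p + q)).coeff g - 2) ^ 2 + ((q * psi 2 (p + q)).coeff g - 2) ^ 2
      = ((p * psi 2 (p + q)).coeff g ^ 2 + (q * psi 2 (p + q)).coeff g ^ 2)
        - 4 * (p * psi 2 (p + q)).coeff g - 4 * (q * psi 2 (p + q)).coeff g + 8 := fun g => by ring
  simp only [e1] at hsum
  simp only [sum_add_distrib, sum_sub_distrib, ← mul_sum, h.sum_const, h.sum_left, h.sum_right,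
    h.sum_psi_left, h.sum_psi_right, h.sum_left_mul, h.sum_right_mul] at hsum
  have hs := h.sum_sq
  rw [sum_add_distrib] at hs
  have h1 := h.left_mul_nonneg 0
  have h2 := h.right_mul_nonneg 0
  have hn1 : (17 : ℤ) ≤ n := by exact_mod_cast hn0
  nlinarith

end SplitPair
end ResidueZero

section ResidueTwo

/-- The deviation of a pair of coefficients `X`, `Y` from the values `1`, `4` expected at generic
group elements. -/
def cost (X Y D a b : ℤ) : ℤ := (X - 1) * (X - 4) + (Y - 1) * (Y - 4) + 4 * D + 2 * a + 2 * b

section Pointwise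

/-- The information available about the coefficients at one group element. -/
structure LocalData (n X Y V p q a b c : ℤ) : Prop where
  n_nonneg : 68 ≤ n
  X_nonneg : 0 ≤ X
  Y_nonneg : 0 ≤ Y
  V_nonneg : 0 ≤ V
  V_le : V ≤ n + 1
  p_nonneg : 0 ≤ p
  q_nonneg : 0 ≤ q
  add_le : p + q ≤ 1
  a_nonneg : 0 ≤ a
  a_le : a ≤ 1
  b_nonneg : 0 ≤ b
  b_le : b ≤ 1
  c_nonneg : 0 ≤ c
  X_mod : 3 ∣ X - (1 + (p + q) - a)
  Y_mod : 3 ∣ Y - (1 + (p + q) - b)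
  V_mod : V ≡ -4 * n * Y - X + (4 * n + 3 + (n + 2) * (n + 1) ^ 2) + (4 * n ^ 2 + 2 * n - 3) * q
    + 2 * n * p - c [ZMOD 5]

variable {n X Y V p q a b c : ℤ} (h : LocalData n X Y V p q a b c)
include h

lemma LocalData.cost_left_nonneg : 0 ≤ (X - 1) * (X - 4) + 2 * (p + q) + 2 * a := by
  obtain ⟨-, hX, -, -, -, hp, hq, hpq, ha, ha', -, -, -, hm, -, -⟩ := h
  have h1 : p + q = 0 ∨ p + q = 1 := by omega
  have h2 : a = 0 ∨ a = 1 := by omega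
  by_cases h4 : 4 ≤ X
  · nlinarith
  · interval_cases X <;> omega

lemma LocalData.cost_right_nonneg : 0 ≤ (Y - 1) * (Y - 4) + 2 * (p + q) + 2 * b := by
  obtain ⟨-, -, hX, -, -, hp, hq, hpq, -, -, ha, ha', -, -, hm, -⟩ := h
  have h1 : p + q = 0 ∨ p + q = 1 := by omega
  have h2 : b = 0 ∨ b = 1 := by omega
  by_cases h4 : 4 ≤ Y
  · nlinarith
  · interval_cases Y <;> omega

lemma LocalData.cost_nonneg : 0 ≤ cost X Y (p + q) a b := by
  have := h.cost_left_nonneg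
  have := h.cost_right_nonneg
  unfold cost; linarith

lemma LocalData.mem_of_generic (hB : p + q + a + b + c = 0) :
    p = 0 ∧ q = 0 ∧ a = 0 ∧ b = 0 ∧ c = 0 ∧ 3 ∣ X - 1 ∧ 3 ∣ Y - 1 := by
  obtain ⟨-, -, -, -, -, hp, hq, hpq, ha, ha', hb, hb', hc, hm, hm', -⟩ := h
  omega

lemma LocalData.V_mod_of_generic {r : ℤ} (hr : n % 5 = r)
    (hB : p = 0 ∧ q = 0 ∧ a = 0 ∧ b = 0 ∧ c = 0 ∧ 3 ∣ X - 1 ∧ 3 ∣ Y - 1) :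
    5 ∣ V - (-4 * r * Y - X + (4 * r + 3 + (r + 2) * (r + 1) ^ 2)) := by
  obtain ⟨rfl, rfl, -, -, rfl, -⟩ := hB
  have h1 := h.V_mod
  have h2 : n ≡ r [ZMOD 5] := by rw [← hr]; exact (Int.mod_modEq n 5).symm
  rw [show (5 : ℤ) = ((5 : ℕ) : ℤ) from rfl, ← ZMod.intCast_eq_intCast_iff] at h1 h2
  have : ((V - (-4 * r * Y - X + (4 * r + 3 + (r + 2) * (r + 1) ^ 2)) : ℤ) : ZMod 5) = 0 := by
    push_cast at h1 h2 ⊢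
    rw [h1, ← h2]; ring
  exact (ZMod.intCast_zmod_eq_zero_iff_dvd _ 5).mp this

lemma LocalData.mul_cost_ge {k : ℤ} (m : ℕ) (hk : k ≤ cost X Y (p + q) a b) :
    (m + n) * k ≤ (m + n) * cost X Y (p + q) a b :=
  mul_le_mul_of_nonneg_left hk (by linarith [h.n_nonneg, Int.natCast_nonneg m])

lemma LocalData.bound_zero_two (hX : X ≤ 7) (hY : Y ≤ 7) (hn : n % 5 = 0 ∨ n % 5 = 2) :
    -12 * (p + q) - 12 * (a + b + c) - (25 + n) * cost X Y (p + q) a b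
      ≤ -12 + 3 * X + 4 * V - X * V := by
  have h0 := h.mul_cost_ge 25 h.cost_nonneg
  have h2 := h.mul_cost_ge 25 (k := (X - 1) * (X - 4)) (by
    have := h.cost_right_nonneg
    unfold cost; linarith [h.p_nonneg, h.q_nonneg, h.a_nonneg, h.b_nonneg])
  have h1 := h.mul_cost_ge 25 (k := (X - 1) * (X - 4) + (Y - 1) * (Y - 4))
    (by unfold cost; linarith [h.p_nonneg, h.q_nonneg, h.a_nonneg, h.b_nonneg])
  have hX0 := h.X_nonneg
  have hY0 := h.Y_nonneg
  have hV0 := h.V_nonneg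
  have hV := h.V_le
  have hn0 := h.n_nonneg
  have h4 := h.p_nonneg
  have h5 := h.q_nonneg
  have h6 := h.a_nonneg
  have h7 := h.b_nonneg
  have h8 := h.c_nonneg
  push_cast at h0 h1 h2
  generalize (25 + n) * cost X Y (p + q) a b = C at *
  by_cases hB : p + q + a + b + c = 0
  · have hg := h.mem_of_generic hB
    rcases hn with hn | hn
    all_goals
      have hv := h.V_mod_of_generic hn hg
      obtain ⟨rfl, rfl, rfl, rfl, rfl, hx, hy⟩ := hg
      interval_cases X <;> try omega
      all_goals interval_cases Y <;> omega
  · interval_cases X <;> interval_cases Y <;> omega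

lemma LocalData.bound_three (hX : X ≤ 7) (hY : Y ≤ 7) (hn : n % 5 = 3) :
    -3 * (p + q) - 9 * (a + b + c) - (19 + n) * cost X Y (p + q) a b
      ≤ 3 - 3 * X - V + X * V := by
  have h0 := h.mul_cost_ge 19 h.cost_nonneg
  have h2 := h.mul_cost_ge 19 (k := (X - 1) * (X - 4)) (by
    have := h.cost_right_nonneg
    unfold cost; linarith [h.p_nonneg, h.q_nonneg, h.a_nonneg, h.b_nonneg])
  have h1 := h.mul_cost_ge 19 (k := (X - 1) * (X - 4) + (Y - 1) * (Y - 4))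
    (by unfold cost; linarith [h.p_nonneg, h.q_nonneg, h.a_nonneg, h.b_nonneg])
  have hX0 := h.X_nonneg
  have hY0 := h.Y_nonneg
  have hV0 := h.V_nonneg
  have hV := h.V_le
  have hn0 := h.n_nonneg
  have h4 := h.p_nonneg
  have h5 := h.q_nonneg
  have h6 := h.a_nonneg
  have h7 := h.b_nonneg
  have h8 := h.c_nonneg
  have h9 := h.X_mod
  have h10 := h.add_le
  push_cast at h0 h1 h2
  generalize (19 + n) * cost X Y (p + q) a b = C at *
  by_cases hB : p + q + a + b + c = 0
  · have hg := h.mem_of_generic hB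
    have hv := h.V_mod_of_generic hn hg
    obtain ⟨rfl, rfl, rfl, rfl, rfl, hx, hy⟩ := hg
    interval_cases X <;> try omega
    all_goals interval_cases Y <;> omega
  · interval_cases X <;> interval_cases Y <;> omega

lemma LocalData.bound_one (hX : X ≤ 7) (hY : Y ≤ 7) (hn : n % 5 = 1) :
    -49 * (p + q) - 49 * (a + b + c) - (73 + n) * cost X Y (p + q) a b
      ≤ -56 + 14 * X + 12 * V - 3 * (X * V) - 2 * (X * Y) + 8 * Y := by
  have h0 := h.mul_cost_ge 73 h.cost_nonneg
  have h2 := h.mul_cost_ge 73 (k := (X - 1) * (X - 4)) (by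
    have := h.cost_right_nonneg
    unfold cost; linarith [h.p_nonneg, h.q_nonneg, h.a_nonneg, h.b_nonneg])
  have h1 := h.mul_cost_ge 73 (k := (X - 1) * (X - 4) + (Y - 1) * (Y - 4))
    (by unfold cost; linarith [h.p_nonneg, h.q_nonneg, h.a_nonneg, h.b_nonneg])
  have hX0 := h.X_nonneg
  have hY0 := h.Y_nonneg
  have hV0 := h.V_nonneg
  have hV := h.V_le
  have hn0 := h.n_nonneg
  have h4 := h.p_nonneg
  have h5 := h.q_nonneg
  have h6 := h.a_nonneg
  have h7 := h.b_nonneg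
  have h8 := h.c_nonneg
  push_cast at h0 h1 h2
  generalize (73 + n) * cost X Y (p + q) a b = C at *
  by_cases hB : p + q + a + b + c = 0
  · have hg := h.mem_of_generic hB
    have hv := h.V_mod_of_generic hn hg
    obtain ⟨rfl, rfl, rfl, rfl, rfl, hx, hy⟩ := hg
    interval_cases X <;> omega
  · interval_cases X <;> interval_cases Y <;> omega

lemma LocalData.bound_four (hX : X ≤ 7) (hY : Y ≤ 7) (hn : n % 5 = 4) :
    -49 * (p + q) - 49 * (a + b + c) - (73 + n) * cost X Y (p + q) a b
      ≤ -16 + 4 * X + 12 * V - 3 * (X * V) + 2 * (X * Y) - 8 * Y := by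
  have h0 := h.mul_cost_ge 73 h.cost_nonneg
  have h2 := h.mul_cost_ge 73 (k := (X - 1) * (X - 4)) (by
    have := h.cost_right_nonneg
    unfold cost; linarith [h.p_nonneg, h.q_nonneg, h.a_nonneg, h.b_nonneg])
  have h1 := h.mul_cost_ge 73 (k := (X - 1) * (X - 4) + (Y - 1) * (Y - 4))
    (by unfold cost; linarith [h.p_nonneg, h.q_nonneg, h.a_nonneg, h.b_nonneg])
  have hX0 := h.X_nonneg
  have hY0 := h.Y_nonneg
  have hV0 := h.V_nonneg
  have hV := h.V_le
  have hn0 := h.n_nonneg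
  have h4 := h.p_nonneg
  have h5 := h.q_nonneg
  have h6 := h.a_nonneg
  have h7 := h.b_nonneg
  have h8 := h.c_nonneg
  push_cast at h0 h1 h2
  generalize (73 + n) * cost X Y (p + q) a b = C at *
  by_cases hB : p + q + a + b + c = 0
  · have hg := h.mem_of_generic hB
    have hv := h.V_mod_of_generic hn hg
    obtain ⟨rfl, rfl, rfl, rfl, rfl, hx, hy⟩ := hg
    interval_cases X <;> try omega
    all_goals interval_cases Y <;> omega
  · interval_cases X <;> interval_cases Y <;> omega

end Pointwise
end ResidueTwo

section ResidueTwoSum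

variable {G : Type*} [AddCommGroup G] [Fintype G]
namespace SplitPair

variable {n : ℕ} {p q : GroupRing G} (h : SplitPair n p q)
include h

lemma localData (hn : n % 3 = 2) (hn0 : 68 ≤ n) (g : G) :
    LocalData n ((p * psi 2 (p + q)).coeff g) ((q * psi 2 (p + q)).coeff g)
      ((q * psi 4 (p + q)).coeff g) (p.coeff g) (q.coeff g) ((psi 3 p).coeff g)
      ((psi 3 q).coeff g) ((psi 5 q).coeff g) := by
  have h3 := h.isCoprime_three (by omega)
  have h1 := h.nonneg_left g
  have h2 := h.nonneg_right g
  have h4 := h.coeff_add_le g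
  obtain ⟨m, rfl⟩ : ∃ m, n = 3 * m + 2 := ⟨n / 3, by omega⟩
  refine ⟨by exact_mod_cast hn0, h.left_mul_nonneg g, h.right_mul_nonneg g,
    (h.right_mul_four_mem g).1, (h.right_mul_four_mem g).2, h1, h2, h4,
    (h.coeff_psi_left_mem h3 g).1, (h.coeff_psi_left_mem h3 g).2,
    (h.coeff_psi_right_mem h3 g).1, (h.coeff_psi_right_mem h3 g).2,
    (h.coeff_psi_right_mem h.isCoprime_five g).1, ?_, ?_, h.right_mul_four_modEq g⟩
  · have h5 := (h.left_mul_modEq g).symm.dvd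
    have h6 : (3 : ℤ) ∣ 2 * ((3 * m + 2 : ℕ) : ℤ) * p.coeff g - p.coeff g :=
      ⟨(2 * m + 1) * p.coeff g, by push_cast; ring⟩
    push_cast at *; omega
  · have h5 := (h.right_mul_modEq g).symm.dvd
    have h6 : (3 : ℤ) ∣ 2 * ((3 * m + 2 : ℕ) : ℤ) * q.coeff g - q.coeff g :=
      ⟨(2 * m + 1) * q.coeff g, by push_cast; ring⟩
    push_cast at *; omega

lemma sum_cost : ∑ g, cost ((p * psi 2 (p + q)).coeff g) ((q * psi 2 (p + q)).coeff g)
      (p.coeff g + q.coeff g) ((psi 3 p).coeff g) ((psi 3 q).coeff g) =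
    9 + ((p * psi 2 (p + q)).coeff 0 + (q * psi 2 (p + q)).coeff 0) := by
  have e : ∀ g, cost ((p * psi 2 (p + q)).coeff g) ((q * psi 2 (p + q)).coeff g)
      (p.coeff g + q.coeff g) ((psi 3 p).coeff g) ((psi 3 q).coeff g) =
      (p * psi 2 (p + q)).coeff g ^ 2 + (q * psi 2 (p + q)).coeff g ^ 2
      - 5 * (p * psi 2 (p + q)).coeff g - 5 * (q * psi 2 (p + q)).coeff g + 8
      + 4 * p.coeff g + 4 * q.coeff g + 2 * (psi 3 p).coeff g + 2 * (psi 3 q).coeff g :=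
    fun g => by unfold cost; ring
  have hs := h.sum_sq
  rw [sum_add_distrib] at hs
  simp only [e, sum_add_distrib, sum_sub_distrib, ← mul_sum, h.sum_const, h.sum_left, h.sum_right,
    h.sum_psi_left, h.sum_psi_right, h.sum_left_mul, h.sum_right_mul]
  linarith

lemma coeff_zero_le (hn : n % 3 = 2) (hn0 : 68 ≤ n) :
    (p * psi 2 (p + q)).coeff 0 + (q * psi 2 (p + q)).coeff 0 ≤ 11 := by
  have h1 := single_le_sum (fun g _ => (h.localData hn hn0 g).cost_nonneg) (mem_univ (0 : G))
  have h3 := h.isCoprime_three (by omega)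
  rw [h.sum_cost] at h1
  have h2 := h.coeff_zero
  have h4 := (h.coeff_psi_left_mem h3 0).1
  have h5 := (h.coeff_psi_right_mem h3 0).1
  simp only [AddMonoidAlgebra.coeff_add, Finsupp.add_apply] at h2
  unfold cost at h1
  rw [h2] at h1
  by_contra! hc
  nlinarith [sq_nonneg ((p * psi 2 (p + q)).coeff 0 - (q * psi 2 (p + q)).coeff 0)]

lemma coeff_mul_le_seven (hn : n % 3 = 2) (hn0 : 68 ≤ n) (g : G) :
    (p * psi 2 (p + q)).coeff g ≤ 7 ∧ (q * psi 2 (p + q)).coeff g ≤ 7 := by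
  have h1 := single_le_sum (fun g _ => (h.localData hn hn0 g).cost_nonneg) (mem_univ g)
  rw [h.sum_cost] at h1
  have h2 := h.coeff_zero_le hn hn0
  have h3 := (h.localData hn hn0 g).cost_left_nonneg
  have h4 := (h.localData hn hn0 g).cost_right_nonneg
  have hd := h.localData hn hn0 g
  have h5 := hd.p_nonneg
  have h6 := hd.q_nonneg
  have h7 := hd.a_nonneg
  have h8 := hd.b_nonneg
  unfold cost at h1
  constructor
  · by_contra! hc; nlinarith
  · by_contra! hc; nlinarith

lemma sum_bound (hn : n % 3 = 2) (hn0 : 68 ≤ n) (m w₁ w₂ u α β γ δ ε : ℤ)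
    (hb : ∀ g, -w₁ * (p.coeff g + q.coeff g)
        - w₂ * ((psi 3 p).coeff g + (psi 3 q).coeff g + (psi 5 q).coeff g)
        - (m + n) * cost ((p * psi 2 (p + q)).coeff g) ((q * psi 2 (p + q)).coeff g)
          (p.coeff g + q.coeff g) ((psi 3 p).coeff g) ((psi 3 q).coeff g)
      ≤ u + α * (p * psi 2 (p + q)).coeff g + β * (q * psi 4 (p + q)).coeff g
        + γ * ((p * psi 2 (p + q)).coeff g * (q * psi 4 (p + q)).coeff g)
        + δ * ((p * psi 2 (p + q)).coeff g * (q * psi 2 (p + q)).coeff g)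
        + ε * (q * psi 2 (p + q)).coeff g) :
    ∃ z : ℤ, 0 ≤ z ∧ z ≤ 11 ∧ -w₁ * (2 * n + 1) - w₂ * (3 * n + 2) - (m + n) * (9 + z) ≤
      (n ^ 2 + n + 1) * u + α * (n * (2 * n + 1)) + β * ((n + 1) * (2 * n + 1))
        + γ * ((2 * n + 1) ^ 2 - z) + δ * ((2 * n + 1) ^ 2 - (2 * n + 1))
        + ε * ((n + 1) * (2 * n + 1)) := by
  refine ⟨_, add_nonneg (h.left_mul_nonneg 0) (h.right_mul_nonneg 0), h.coeff_zero_le hn hn0, ?_⟩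
  have hs := sum_le_sum fun g (_ : g ∈ univ) => hb g
  simp only [sum_add_distrib, sum_sub_distrib, ← mul_sum, h.sum_const, h.sum_left, h.sum_right,
    h.sum_psi_left, h.sum_psi_right, h.sum_left_mul, h.sum_right_mul, h.sum_cost, h.sum_mul,
    h.sum_mul_four] at hs
  linarith

/-- There is no split pair when `n` is congruent to two modulo three and large. -/
theorem false_of_mod_three_eq_two (hn : n % 3 = 2) (hn0 : 68 ≤ n) : False := by
  have hl := fun g => h.localData hn hn0 g
  have h7 := fun g => h.coeff_mul_le_seven hn hn0 g
  have hn1 : (68 : ℤ) ≤ n := by exact_mod_cast hn0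
  have h5 : n % 5 = 0 ∨ n % 5 = 1 ∨ n % 5 = 2 ∨ n % 5 = 3 ∨ n % 5 = 4 := by omega
  rcases h5 with h5 | h5 | h5 | h5 | h5
  · obtain ⟨z, hz, hz', hb⟩ := h.sum_bound hn hn0 25 12 12 (-12) 3 4 (-1) 0 0 fun g => by
      linarith [(hl g).bound_zero_two (h7 g).1 (h7 g).2 (by omega)]
    nlinarith
  · obtain ⟨z, hz, hz', hb⟩ := h.sum_bound hn hn0 73 49 49 (-56) 14 12 (-3) (-2) 8 fun g => by
      linarith [(hl g).bound_one (h7 g).1 (h7 g).2 (by omega)]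
    nlinarith
  · obtain ⟨z, hz, hz', hb⟩ := h.sum_bound hn hn0 25 12 12 (-12) 3 4 (-1) 0 0 fun g => by
      linarith [(hl g).bound_zero_two (h7 g).1 (h7 g).2 (by omega)]
    nlinarith
  · obtain ⟨z, hz, hz', hb⟩ := h.sum_bound hn hn0 19 3 9 3 (-3) (-1) 1 0 0 fun g => by
      linarith [(hl g).bound_three (h7 g).1 (h7 g).2 (by omega)]
    nlinarith
  · have hn2 : (74 : ℤ) ≤ n := by omega
    obtain ⟨z, hz, hz', hb⟩ := h.sum_bound hn hn0 73 49 49 (-16) 4 12 (-3) 2 (-8) fun g => by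
      linarith [(hl g).bound_four (h7 g).1 (h7 g).2 (by omega)]
    nlinarith

end SplitPair
end ResidueTwoSum

section Characters

lemma exists_addMonoidHom_eq_one {K V : Type*} [Field K] [AddCommGroup V] [Module K V] {x : V}
    (hx : x ≠ 0) : ∃ f : V →+ K, f x = 1 := by
  obtain ⟨f, hf⟩ : ∃ f : Module.Dual K V, f x ≠ 0 := by
    by_contra! hall
    exact hx ((Module.forall_dual_apply_eq_zero_iff K _).mp hall)
  exact ⟨((f x)⁻¹ • f).toAddMonoidHom, by simp [hf]⟩

/-- A finite abelian group whose order is divisible by the prime `ℓ` maps onto `ZMod ℓ`. -/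
lemma exists_surjective_zmod {H : Type*} [AddCommGroup H] [Fintype H] {ℓ : ℕ} [hl : Fact ℓ.Prime]
    (hd : ℓ ∣ Fintype.card H) : ∃ θ : H →+ ZMod ℓ, ∃ t, θ t = 1 := by
  let R : AddSubgroup H := (nsmulAddMonoidHom ℓ : H →+ H).range
  have hR : ∃ x, x ∉ R := by
    by_contra! hall
    have hs : Function.Surjective (nsmulAddMonoidHom ℓ : H →+ H) := fun x => hall x
    have hi := Finite.injective_iff_surjective.mpr hs
    obtain ⟨x, hx⟩ := exists_prime_addOrderOf_dvd_card ℓ hd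
    have h0 : x = 0 := hi (by
      simp only [nsmulAddMonoidHom_apply, smul_zero]
      rw [← hx]; exact addOrderOf_nsmul_eq_zero x)
    rw [h0, addOrderOf_zero] at hx
    exact hl.out.one_lt.ne hx
  obtain ⟨x, hx⟩ := hR
  let : Module (ZMod ℓ) (H ⧸ R) := AddCommGroup.zmodModule (by
    intro y
    obtain ⟨y, rfl⟩ := QuotientAddGroup.mk_surjective y
    rw [← QuotientAddGroup.mk_nsmul, QuotientAddGroup.eq_zero_iff]
    exact ⟨y, rfl⟩)
  have hx0 : (QuotientAddGroup.mk x : H ⧸ R) ≠ 0 := by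
    rwa [Ne, QuotientAddGroup.eq_zero_iff]
  obtain ⟨f, hf⟩ := exists_addMonoidHom_eq_one (K := ZMod ℓ) hx0
  exact ⟨f.comp (QuotientAddGroup.mk' R), x, hf⟩

variable {G : Type*} [AddCommGroup G] {H : Type*} [AddCommGroup H]

/-- The map of group rings induced by a homomorphism of groups. -/
noncomputable def push (θ : G →+ H) : GroupRing G →+* GroupRing H :=
  AddMonoidAlgebra.mapDomainRingHom ℤ θ

lemma push_mono (θ : G →+ H) (g : G) : push θ (mono g) = mono (θ g) := by
  simp [push, mono]

lemma push_psi (θ : G →+ H) (k : ℤ) (x : GroupRing G) : push θ (psi k x) = psi k (push θ x) :=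
  ringHom_eq_of_mono (f := (push θ).comp (psi k)) (f' := (psi k).comp (push θ))
    (fun g => by simp [push_mono, psi_mono]) x

variable [Fintype G]

lemma mono_mul_push_total (θ : G →+ H) (t : G) :
    mono (θ t) * push θ (total G) = push θ (total G) := by
  rw [← push_mono, ← map_mul, mono_mul_total]

lemma coeff_push_total [Fintype H] (θ : G →+ H) (t : G) :
    (push θ (total G)).coeff (θ t) = (push θ (total G)).coeff 0 := by
  classical
  conv_lhs => rw [← mono_mul_push_total θ t]
  rw [coeff_mul_apply, sum_eq_single (θ t)]
  · simp [coeff_mono]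
  · intro b _ hb; simp [coeff_mono, hb.symm]
  · simp

namespace SplitPair

variable {n : ℕ} {p q : GroupRing G} (h : SplitPair n p q)
include h

/-- There is no split pair when `n > 1` is congruent to one modulo three. -/
theorem false_of_mod_three_eq_one (hn : n % 3 = 1) (hn1 : 1 < n) : False := by
  have hz : ∀ g : ZMod 3, (2 : ℤ) • g = (-1 : ℤ) • g := by decide
  have hz1 : (0 : ZMod 3) ≠ 1 := by decide
  have hd : 3 ∣ Fintype.card G := by
    rw [h.card]
    obtain ⟨m, rfl⟩ : ∃ m, n = 3 * m + 1 := ⟨n / 3, by omega⟩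
    exact ⟨3 * m ^ 2 + 3 * m + 1, by ring⟩
  obtain ⟨θ, t, ht⟩ := exists_surjective_zmod (hl := ⟨Nat.prime_three⟩) hd
  have hU := coeff_push_total θ t
  rw [ht] at hU
  have h1 := congrArg (push θ) h.mul_eq
  have h2 := congrArg (push θ) h.sq_eq
  have hp : psi (-1) (push θ p) = push θ p := by rw [← push_psi, h.symm_left]
  have hq : psi (-1) (push θ q) = push θ q := by rw [← push_psi, h.symm_right]
  simp only [map_mul, map_add, map_sub, map_pow, push_psi, map_one, map_ofNat, map_natCast]
    at h1 h2
  generalize push θ p = P at *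
  generalize push θ q = Q at *
  generalize push θ (total G) = U at *
  have hp2 : P.coeff 2 = P.coeff 1 := coeff_neg_of_psi hp 1
  have hq2 : Q.coeff 2 = Q.coeff 1 := coeff_neg_of_psi hq 1
  have hψ : ∀ x : GroupRing (ZMod 3), psi (-1) x = x → psi 2 x = x := fun x hx => by
    conv_rhs => rw [← hx]
    refine ringHom_eq_of_mono (f := psi 2) (f' := psi (-1)) (fun g => ?_) x
    rw [psi_mono, psi_mono]; rw [hz]
  rw [hψ P hp, hψ Q hq] at h2
  have hone : (1 : GroupRing (ZMod 3)).coeff 1 = 0 := by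
    rw [← mono_zero, coeff_mono, if_neg hz1]
  have hsum : ∀ f : ZMod 3 → ℤ, ∑ i, f i = f 0 + f 1 + f 2 := fun f => Fin.sum_univ_three f
  have hm0 : ∀ x y : GroupRing (ZMod 3), (x * y).coeff 0 =
      x.coeff 0 * y.coeff 0 + x.coeff 1 * y.coeff 2 + x.coeff 2 * y.coeff 1 := fun x y => by
    rw [coeff_mul_apply, hsum]; rfl
  have hm1 : ∀ x y : GroupRing (ZMod 3), (x * y).coeff 1 =
      x.coeff 0 * y.coeff 1 + x.coeff 1 * y.coeff 0 + x.coeff 2 * y.coeff 2 := fun x y => by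
    rw [coeff_mul_apply, hsum]; rfl
  have h2' : P * P + Q * Q + (P + Q) = ((2 : ℕ) : GroupRing (ZMod 3)) * U
      + ((2 * n : ℕ) : GroupRing (ZMod 3)) * 1 := by
    push_cast; linear_combination h2
  have a0 := congrArg (fun x => x.coeff 0) h1
  have a1 := congrArg (fun x => x.coeff 1) h1
  have b0 := congrArg (fun x => x.coeff 0) h2'
  have b1 := congrArg (fun x => x.coeff 1) h2'
  simp only [AddMonoidAlgebra.coeff_add, Finsupp.add_apply, coeff_nat_mul] at b0 b1
  simp only [AddMonoidAlgebra.coeff_sub, Finsupp.sub_apply, hm0, hm1, hp2, hq2, coeff_one_zero,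
    hone, hU] at a0 a1 b0 b1
  have e1 : (P.coeff 0 - P.coeff 1) * (Q.coeff 0 - Q.coeff 1) = -1 := by linarith
  have e2 : (P.coeff 0 - P.coeff 1) ^ 2 + (Q.coeff 0 - Q.coeff 1) ^ 2
      + (P.coeff 0 - P.coeff 1) + (Q.coeff 0 - Q.coeff 1) = 2 * n := by push_cast at b0 b1; linarith
  rcases Int.mul_eq_neg_one_iff_eq_one_or_neg_one.mp e1 with ⟨e3, e4⟩ | ⟨e3, e4⟩ <;>
  · rw [e3, e4] at e2; norm_num at e2; omega

/-- There is no split pair for `n = 23`. -/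
theorem ne_twentyThree : n ≠ 23 := by
  rintro rfl
  have hz : ∀ y : ZMod 7, (8 : ℤ) • y = y := by decide
  have hζ : (7 : ZMod 29) ^ 7 = 1 := by decide
  have hζ1 : (7 : ZMod 29) ^ (1 : ZMod 7).val ≠ 1 := by decide
  have k : ∀ d : ZMod 29, (44 - (44 - d ^ 2) ^ 2) ^ 2 + d = 44 →
      (∃ e : ZMod 29, e ^ 2 = d ^ 2 + 4) → (∃ e : ZMod 29, e ^ 2 = (44 - d ^ 2) ^ 2 + 4) →
      (∃ e : ZMod 29, e ^ 2 = (44 - (44 - d ^ 2) ^ 2) ^ 2 + 4) → False := by decide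
  have : Fact (Nat.Prime 29) := ⟨by norm_num⟩
  obtain ⟨θ, t, ht⟩ := exists_surjective_zmod (hl := ⟨Nat.prime_seven⟩) (H := G)
    (by rw [h.card]; norm_num)
  let ζ : AddChar (ZMod 7) (ZMod 29) := AddChar.zmodChar 7 hζ
  let χ : GroupRing G →+* ZMod 29 :=
    (AddMonoidAlgebra.lift ℤ (ZMod 29) G
      (ζ.toMonoidHom.comp θ.toMultiplicative) : GroupRing G →ₐ[ℤ] ZMod 29).toRingHom
  have hχ : ∀ g, χ (mono g) = ζ (θ g) := fun g => by
    simp [χ, mono]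
  have hU : χ (total G) = 0 := by
    have h1 := congrArg χ (mono_mul_total t)
    rw [map_mul, hχ, ht] at h1
    have h2 : ζ 1 ≠ 1 := hζ1
    have h3 : (ζ 1 - 1) * χ (total G) = 0 := by linear_combination h1
    exact (mul_eq_zero.mp h3).resolve_left (sub_ne_zero.mpr h2)
  have h8 : ∀ x, χ (psi 8 x) = χ x := fun x =>
    ringHom_eq_of_mono (f := χ.comp (psi 8)) (f' := χ) (fun g => by
      rw [RingHom.comp_apply, psi_mono, hχ, hχ, map_zsmul, hz]) x
  have hD : (p + q) ^ 2 + psi 2 (p + q) = 4 * total G + 44 := by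
    have := h.add_sq; push_cast at this; linear_combination this
  have hE : (p - q) ^ 2 = (p + q) ^ 2 - 4 * total G + 4 := by linear_combination (-4) * h.mul_eq
  have d0 := congrArg χ hD
  have d1 := congrArg (fun x => χ (psi 2 x)) hD
  have d2 := congrArg (fun x => χ (psi 4 x)) hD
  have e0 := congrArg χ hE
  have e1 := congrArg (fun x => χ (psi 2 x)) hE
  have e2 := congrArg (fun x => χ (psi 4 x)) hE
  simp only [map_add, map_sub, map_mul, map_pow, map_ofNat, psi_psi,
    psi_total h.isCoprime_two, psi_total h.isCoprime_four, hU] at d0 d1 d2 e0 e1 e2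
  norm_num [h8] at d0 d1 d2 e0 e1 e2
  have hd1 : χ (psi 2 (p + q)) = 44 - χ (p + q) ^ 2 := by
    simp only [map_add]; linear_combination d0
  have hd2 : χ (psi 4 (p + q)) = 44 - (44 - χ (p + q) ^ 2) ^ 2 := by
    rw [← hd1]; simp only [map_add]; linear_combination d1
  refine k (χ (p + q)) ?_ ⟨χ (p - q), ?_⟩ ⟨χ (psi 2 (p - q)), ?_⟩ ⟨χ (psi 4 (p - q)), ?_⟩
  · rw [← hd2]; simp only [map_add]; linear_combination d2
  · simp only [map_add, map_sub]; linear_combination e0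
  · rw [← hd1]; simp only [map_add, map_sub]; linear_combination e1
  · rw [← hd2]; simp only [map_add, map_sub]; linear_combination e2

end SplitPair
end Characters

section Moments

variable {G : Type*} [AddCommGroup G] [Fintype G] {ℓ : ℕ}

/-- The `k`-th moment of a group ring element along a homomorphism to `ZMod ℓ`. -/
noncomputable def moment (θ : G →+ ZMod ℓ) (k : ℕ) (x : GroupRing G) : ZMod ℓ :=
  ∑ g, (x.coeff g : ZMod ℓ) * θ g ^ k

variable (θ : G →+ ZMod ℓ)

lemma moment_add (k : ℕ) (x y : GroupRing G) :
    moment θ k (x + y) = moment θ k x + moment θ k y := by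
  simp [moment, add_mul, sum_add_distrib]

lemma moment_nat_mul (k m : ℕ) (x : GroupRing G) :
    moment θ k ((m : GroupRing G) * x) = m * moment θ k x := by
  simp [moment, coeff_nat_mul, mul_sum, mul_assoc]

lemma moment_one {k : ℕ} (hk : 0 < k) : moment θ k 1 = 0 := by
  classical
  refine sum_eq_zero fun g _ => ?_
  rw [← mono_zero, coeff_mono]
  split_ifs with hg
  · rw [← hg, map_zero, zero_pow hk.ne', mul_zero]
  · simp

lemma moment_zero (x : GroupRing G) : moment θ 0 x = (aug x : ZMod ℓ) := by
  simp [moment, aug_eq_sum]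

lemma moment_mul (k : ℕ) (x y : GroupRing G) : moment θ k (x * y) =
    ∑ j ∈ range (k + 1), (k.choose j : ZMod ℓ) * moment θ j x * moment θ (k - j) y := by
  have h1 : moment θ k (x * y) =
      ∑ a, ∑ b, (x.coeff a : ZMod ℓ) * (y.coeff b : ZMod ℓ) * (θ a + θ b) ^ k := by
    simp only [moment, coeff_mul_apply, Int.cast_sum, sum_mul, Int.cast_mul]
    rw [sum_comm]
    refine sum_congr rfl fun a _ => ?_
    refine Fintype.sum_equiv (Equiv.subRight a) _ _ fun b => ?_
    simp
  rw [h1]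
  simp only [moment, add_pow, mul_sum, sum_mul]
  rw [sum_comm' (t' := univ) (s' := fun _ => univ) (by simp)]
  simp only [sum_comm (t := range (k + 1))]
  refine sum_congr rfl fun j _ => sum_congr rfl fun b _ => sum_congr rfl fun a _ => ?_
  ring

lemma moment_psi {m : ℤ} (hm : IsCoprime m (Fintype.card G : ℤ)) (k : ℕ) (x : GroupRing G) :
    moment θ k (psi m x) = (m : ZMod ℓ) ^ k * moment θ k x := by
  have hb : Function.Bijective (fun g : G => m • g) :=
    ⟨zsmul_injective_of_coprime hm, exists_smul_eq hm⟩
  rw [moment, moment, ← hb.sum_comp, mul_sum]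
  refine sum_congr rfl fun g _ => ?_
  rw [coeff_psi_smul hm, map_zsmul, zsmul_eq_mul, mul_pow]
  ring

lemma moment_total [hl : Fact ℓ.Prime] (hθ : ∃ t, θ t = 1) {k : ℕ} (hk : k < ℓ - 1) :
    moment θ k (total G) = 0 := by
  classical
  obtain ⟨t, ht⟩ := hθ
  have hsurj : Function.Surjective θ := fun y => ⟨y.val • t, by simp [ht]⟩
  have hfib : ∀ y : ZMod ℓ, #{g | θ g = y} = #{g | θ g = 0} := fun y => by
    obtain ⟨s, rfl⟩ := hsurj y
    refine card_bij' (fun g _ => g - s) (fun g _ => g + s) ?_ ?_ ?_ ?_ <;> simp [sub_eq_zero]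
  have h1 : moment θ k (total G) = ∑ y : ZMod ℓ, ∑ g with θ g = y, θ g ^ k := by
    rw [sum_fiberwise]; simp [moment, coeff_total]
  have h2 : ∀ y : ZMod ℓ, ∑ g with θ g = y, θ g ^ k = (#{g | θ g = 0} : ZMod ℓ) * y ^ k := by
    intro y
    rw [sum_congr rfl (g := fun _ => y ^ k) (fun g hg => by rw [(mem_filter.mp hg).2])]
    rw [sum_const, hfib, nsmul_eq_mul]
  simp_rw [h1, h2, ← mul_sum]
  rw [FiniteField.sum_pow_lt_card_sub_one (ZMod ℓ) k (by rwa [ZMod.card]), mul_zero]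

open Polynomial in
/-- Nonzero elements with vanishing power sums in small characteristic do not exist. -/
lemma eq_empty_of_power_sums {ι K : Type*} [Field K] (J : Finset ι) (y : ι → K)
    (hy : ∀ i ∈ J, y i ≠ 0) (hJ : J.Nonempty → (#J : K) ≠ 0)
    (hs : ∀ k, 0 < k → k ≤ #J → ∑ i ∈ J, y i ^ k = 0) : J = ∅ := by
  by_contra hne
  have hne' := nonempty_iff_ne_empty.mpr hne
  let f : K[X] := ∏ i ∈ J, (X - C (y i))
  have hdeg : f.natDegree = #J := natDegree_finsetProd_X_sub_C_eq_card J y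
  have h0 : ∑ i ∈ J, f.eval (y i) = 0 := sum_eq_zero fun i hi => by
    simp only [f, eval_prod]
    exact prod_eq_zero hi (by simp)
  have h1 : ∑ i ∈ J, f.eval (y i) = #J * f.coeff 0 := by
    simp_rw [eval_eq_sum_range]
    rw [sum_comm, sum_eq_single_of_mem 0 (by simp)]
    · simp
    · intro k hk hk0
      rw [← mul_sum, hs k (Nat.pos_of_ne_zero hk0) (by rw [mem_range, hdeg] at hk; omega), mul_zero]
  have h2 : f.coeff 0 ≠ 0 := by
    rw [coeff_zero_eq_eval_zero]
    simp only [f, eval_prod]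
    exact prod_ne_zero_iff.mpr fun i hi => by simp [hy i hi]
  exact mul_ne_zero (hJ hne') h2 (h1.symm.trans h0)

namespace SplitPair

variable {n : ℕ} {p q : GroupRing G} (h : SplitPair n p q)
include h

lemma moment_eq_zero [hl : Fact ℓ.Prime] (hθ : ∃ t, θ t = 1) (hn : 1 < n) (hln : n + 1 < ℓ)
    (hpow : ∀ k, 0 < k → k ≤ n / 2 → ¬ ℓ ∣ 4 ^ k + (4 * n + 2)) (k : ℕ) (hk : 0 < k)
    (hkn : k ≤ n) : moment θ k p = 0 ∧ moment θ k q = 0 := by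
  induction k using Nat.strong_induction_on with
  | _ k ih =>
  have hmul : ∀ x y : GroupRing G, (∀ j, 0 < j → j < k → moment θ j x = 0) →
      moment θ k (x * y) = moment θ 0 x * moment θ k y + moment θ k x * moment θ 0 y := by
    intro x y hx
    rw [moment_mul, sum_range_succ, sum_range_eq_add_Ico _ hk, sum_eq_zero]
    · simp
    · intro j hj
      rw [mem_Ico] at hj
      rw [hx j (by omega) (by omega)]; ring
  have hp := fun j hj hjk => (ih j hjk hj (by omega)).1
  have hq := fun j hj hjk => (ih j hjk hj (by omega)).2
  rcases Nat.even_or_odd' k with ⟨m, hm | hm⟩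
  · have hU := moment_total θ hθ (k := k) (by omega)
    have h1 := congrArg (moment θ k) (show p * q + 1 = total G by rw [h.mul_eq]; ring)
    have h2 := congrArg (moment θ k) (show p * p + q * q + psi 2 (p + q)
      = (2 : ℕ) * total G + ((2 * n : ℕ) : GroupRing G) * 1 by
        push_cast; linear_combination h.sq_eq)
    simp only [moment_add, moment_nat_mul, moment_one θ hk, hU, hmul p q hp, hmul p p hp,
      hmul q q hq, moment_psi θ h.isCoprime_two, moment_zero, h.aug_left, h.aug_right] at h1 h2
    push_cast at h1 h2
    generalize moment θ k p = A at *
    generalize moment θ k q = B at *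
    have h3 : (4 ^ m + (4 * n + 2) : ZMod ℓ) ≠ 0 := by
      have := hpow m (by omega) (by omega)
      rw [← ZMod.natCast_eq_zero_iff] at this
      push_cast at this; exact this
    have h4 : (2 : ZMod ℓ) ^ k = 4 ^ m := by rw [hm, pow_mul]; norm_num
    rw [h4] at h2
    have h5 : (4 ^ m + (4 * n + 2) : ZMod ℓ) * (A + B) = 0 := by
      linear_combination h2 + 2 * h1
    have h6 := (mul_eq_zero.mp h5).resolve_left h3
    have hB : B = 0 := by linear_combination (n + 1) * h6 - h1
    exact ⟨by linear_combination h6 - hB, hB⟩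
  · have h2 : (2 : ZMod ℓ) ≠ 0 := by
      intro h0
      have : ((2 : ℕ) : ZMod ℓ) = 0 := by exact_mod_cast h0
      rw [ZMod.natCast_eq_zero_iff] at this
      exact absurd (Nat.le_of_dvd (by norm_num) this) (by omega)
    have hodd : ∀ x : GroupRing G, psi (-1) x = x → moment θ k x = 0 := fun x hx => by
      have h3 := moment_psi θ (m := -1) (isCoprime_one_left.neg_left) k x
      rw [hx, hm] at h3
      push_cast at h3
      rw [Odd.neg_one_pow ⟨m, rfl⟩, ← hm] at h3
      have h4 : 2 * moment θ k x = 0 := by linear_combination h3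
      exact (mul_eq_zero.mp h4).resolve_left h2
    exact ⟨hodd p h.symm_left, hodd q h.symm_right⟩

/-- The moment obstruction to the existence of a split pair. -/
theorem false_of_prime (hl : ℓ.Prime) (hd : ℓ ∣ n ^ 2 + n + 1) (hn : 1 < n) (hln : n + 1 < ℓ)
    (hpow : ∀ k, 0 < k → k ≤ n / 2 → ¬ ℓ ∣ 4 ^ k + (4 * n + 2)) : False := by
  classical
  have : Fact ℓ.Prime := ⟨hl⟩
  obtain ⟨θ, hθ⟩ := exists_surjective_zmod (H := G) (h.card ▸ hd)
  have hp1 : ∀ g, p.coeff g = 0 ∨ p.coeff g = 1 := fun g => by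
    have := h.nonneg_left g; have := h.nonneg_right g; have := h.coeff_add_le g
    omega
  let J : Finset G := {g | p.coeff g = 1 ∧ θ g ≠ 0}
  have hJ : ∀ g, g ∈ J ↔ p.coeff g = 1 ∧ θ g ≠ 0 := fun g => by simp [J]
  have hcard : #J ≤ n := by
    have h1 : (#J : ℤ) ≤ ∑ g, p.coeff g := by
      rw [card_eq_sum_ones, Nat.cast_sum]
      refine (sum_le_sum fun g hg => ?_).trans
        (sum_le_sum_of_subset_of_nonneg (subset_univ J) fun g _ _ => h.nonneg_left g)
      rw [((hJ g).mp hg).1]; simp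
    rw [h.sum_left] at h1
    exact_mod_cast h1
  have hempty : J = ∅ := by
    refine eq_empty_of_power_sums J θ (fun g hg => ((hJ g).mp hg).2) (fun hne h0 => ?_)
      fun k hk hkJ => ?_
    · rw [ZMod.natCast_eq_zero_iff] at h0
      have := Nat.le_of_dvd hne.card_pos h0
      omega
    · rw [← (h.moment_eq_zero θ hθ hn hln hpow k hk (hkJ.trans hcard)).1, moment]
      refine sum_subset_zero_on_sdiff (subset_univ J) (fun g hg => ?_) fun g hg => ?_
      · have h1 : ¬ (p.coeff g = 1 ∧ θ g ≠ 0) := fun h1 => (mem_sdiff.mp hg).2 ((hJ g).mpr h1)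
        rcases hp1 g with h2 | h2
        · simp [h2]
        · have h3 : θ g = 0 := by by_contra h3; exact h1 ⟨h2, h3⟩
          simp [h3, hk.ne']
      · rw [((hJ g).mp hg).1]; simp
  have hpush : push θ p = (n : GroupRing (ZMod ℓ)) := by
    conv_lhs => rw [eq_sum_mono p]
    have h1 : ∀ g, push θ ((p.coeff g : GroupRing G) * mono g) = (p.coeff g : ℤ) := fun g => by
      rw [map_mul, map_intCast, push_mono]
      rcases hp1 g with h2 | h2
      · simp [h2]
      · have h3 : θ g = 0 := by
          by_contra h3
          have := (hJ g).mpr ⟨h2, h3⟩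
          rw [hempty] at this; simp at this
        rw [h3, mono_zero, mul_one]
    rw [map_sum]
    simp_rw [h1]
    rw [← Int.cast_sum, h.sum_left, Int.cast_natCast]
  obtain ⟨t, ht⟩ := hθ
  have hU := coeff_push_total θ t
  rw [ht] at hU
  have h1 := congrArg (push θ) h.mul_eq
  rw [map_mul, map_sub, map_one, hpush] at h1
  have c0 := congrArg (fun x => x.coeff 0) h1
  have c1 := congrArg (fun x => x.coeff 1) h1
  simp only [AddMonoidAlgebra.coeff_sub, Finsupp.sub_apply, coeff_nat_mul, hU, ← mono_zero,
    coeff_mono, if_neg (zero_ne_one' (ZMod ℓ))] at c0 c1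
  have h2 : (n : ℤ) ∣ 1 :=
    ⟨(push θ q).coeff 1 - (push θ q).coeff 0, by rw [mul_sub, c0, c1]; simp⟩
  have := Int.le_of_dvd one_pos h2
  omega

end SplitPair
end Moments

section Classification

variable {G : Type*} [AddCommGroup G] [Fintype G]
namespace SplitPair

variable {n : ℕ} {p q : GroupRing G}

/-- Split pairs do not exist outside the exceptional parameters. -/
theorem not_of_not_mem (hn : 0 < n)
    (hexc : n ∉ ({1, 2, 11, 29, 47, 56, 67, 79, 104, 121, 134, 191} : Set ℕ)) :
    ¬ SplitPair n p q := by
  intro h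
  simp only [Set.mem_insert_iff, Set.mem_singleton_iff, not_or] at hexc
  have h3 : n % 3 = 0 ∨ n % 3 = 1 ∨ n % 3 = 2 := by omega
  rcases h3 with h3 | h3 | h3
  · rcases le_or_gt 17 n with hn17 | hn17
    · exact h.false_of_mod_three_eq_zero h3 hn17
    · have hcases : n = 3 ∨ n = 6 ∨ n = 9 ∨ n = 12 ∨ n = 15 := by omega
      obtain ⟨ℓ, hl, hd, hln, hpow⟩ : ∃ ℓ : ℕ, ℓ.Prime ∧ ℓ ∣ n ^ 2 + n + 1 ∧ n + 1 < ℓ ∧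
          ∀ k ∈ Finset.Icc 1 (n / 2), ¬ ℓ ∣ 4 ^ k + (4 * n + 2) := by
        rcases hcases with rfl | rfl | rfl | rfl | rfl
        · exact ⟨13, by norm_num, by norm_num, by norm_num, by decide⟩
        · exact ⟨43, by norm_num, by norm_num, by norm_num, by decide⟩
        · exact ⟨13, by norm_num, by norm_num, by norm_num, by decide⟩
        · exact ⟨157, by norm_num, by norm_num, by norm_num, by decide⟩
        · exact ⟨241, by norm_num, by norm_num, by norm_num, by decide⟩
      exact h.false_of_prime hl hd (by omega) hln fun k hk hkn =>
        hpow k (Finset.mem_Icc.mpr ⟨hk, hkn⟩)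
  · exact h.false_of_mod_three_eq_one h3 (by omega)
  · rcases le_or_gt 68 n with hn68 | hn68
    · exact h.false_of_mod_three_eq_two h3 hn68
    · have h23 := h.ne_twentyThree
      have hcases : n = 5 ∨ n = 8 ∨ n = 14 ∨ n = 17 ∨ n = 20 ∨ n = 26 ∨ n = 32 ∨ n = 35 ∨
          n = 38 ∨ n = 41 ∨ n = 44 ∨ n = 50 ∨ n = 53 ∨ n = 59 ∨ n = 62 ∨ n = 65 := by omega
      obtain ⟨ℓ, hl, hd, hln, hpow⟩ : ∃ ℓ : ℕ, ℓ.Prime ∧ ℓ ∣ n ^ 2 + n + 1 ∧ n + 1 < ℓ ∧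
          ∀ k ∈ Finset.Icc 1 (n / 2), ¬ ℓ ∣ 4 ^ k + (4 * n + 2) := by
        rcases hcases with rfl | rfl | rfl | rfl | rfl | rfl | rfl | rfl | rfl | rfl | rfl | rfl |
          rfl | rfl | rfl | rfl
        · exact ⟨31, by norm_num, by norm_num, by norm_num, by decide⟩
        · exact ⟨73, by norm_num, by norm_num, by norm_num, by decide⟩
        · exact ⟨211, by norm_num, by norm_num, by norm_num, by decide⟩
        · exact ⟨307, by norm_num, by norm_num, by norm_num, by decide⟩
        · exact ⟨421, by norm_num, by norm_num, by norm_num, by decide⟩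
        · exact ⟨37, by norm_num, by norm_num, by norm_num, by decide⟩
        · exact ⟨151, by norm_num, by norm_num, by norm_num, by decide⟩
        · exact ⟨97, by norm_num, by norm_num, by norm_num, by decide⟩
        · exact ⟨1483, by norm_num, by norm_num, by norm_num, by decide⟩
        · exact ⟨1723, by norm_num, by norm_num, by norm_num, by decide⟩
        · exact ⟨283, by norm_num, by norm_num, by norm_num, by decide⟩
        · exact ⟨2551, by norm_num, by norm_num, by norm_num, by decide⟩
        · exact ⟨409, by norm_num, by norm_num, by norm_num, by decide⟩
        · exact ⟨3541, by norm_num, by norm_num, by norm_num, by decide⟩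
        · exact ⟨3907, by norm_num, by norm_num, by norm_num, by decide⟩
        · exact ⟨613, by norm_num, by norm_num, by norm_num, by decide⟩
      exact h.false_of_prime hl hd (by omega) hln fun k hk hkn =>
        hpow k (Finset.mem_Icc.mpr ⟨hk, hkn⟩)

end SplitPair
end Classification

section Reduction

lemma intCast_mul_cancel {G : Type*} [AddCommGroup G] {c : ℤ} (hc : c ≠ 0) {x y : GroupRing G}
    (hxy : (c : GroupRing G) * x = c * y) : x = y := by
  ext g
  have h1 := congrArg (fun z => z.coeff g) hxy
  simp only [coeff_int_mul] at h1
  exact mul_left_cancel₀ hc h1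

lemma coeff_sum_mono_nonneg {G ι : Type*} [AddCommGroup G] (s : Finset ι) (w : ι → G) (g : G) :
    0 ≤ (∑ i ∈ s, mono (w i)).coeff g := by
  classical
  rw [AddMonoidAlgebra.coeff_sum, Finsupp.finsetSum_apply]
  refine sum_nonneg fun i _ => ?_
  rw [coeff_mono]; split_ifs <;> norm_num

lemma psi_neg_sum_mono {G ι : Type*} [AddCommGroup G] (s : Finset ι) (w : ι → G) (ν : ι ≃ ι)
    (hν : ∀ i, w (ν i) = - w i) (hs : ∀ i, ν i ∈ s ↔ i ∈ s) :
    psi (-1) (∑ i ∈ s, mono (w i)) = ∑ i ∈ s, mono (w i) := by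
  rw [map_sum]
  simp_rw [psi_mono]
  exact sum_equiv ν (fun i => (hs i).symm) fun i _ => by rw [hν, neg_one_zsmul]

/-- A finite group of order twice an odd number contains at most one involution. -/
lemma eq_zero_or_eq_of_two_nsmul {G : Type*} [AddCommGroup G] {f : G} (hff : 2 • f = 0)
    {m : ℕ} (hm : Odd m) (hH : ∀ x : G ⧸ AddSubgroup.zmultiples f, m • x = 0) {y : G}
    (hy : 2 • y = 0) : y = 0 ∨ y = f := by
  obtain ⟨k, rfl⟩ := hm
  have h1 := hH y
  have h2 : (y : G ⧸ AddSubgroup.zmultiples f) = 0 := by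
    rw [← QuotientAddGroup.mk_nsmul, add_smul, mul_comm, mul_smul, hy, smul_zero, zero_add,
      one_smul] at h1
    exact h1
  rw [QuotientAddGroup.eq_zero_iff, AddSubgroup.mem_zmultiples_iff] at h2
  obtain ⟨j, rfl⟩ := h2
  have h3 : (2 : ℤ) • f = 0 := by exact_mod_cast hff
  rcases Int.even_or_odd' j with ⟨i, rfl | rfl⟩
  · left; rw [mul_comm, mul_smul, h3, smul_zero]
  · right; rw [add_smul, mul_comm, mul_smul, h3, smul_zero, zero_add, one_smul]

/-- The ring equation of a code with uncovered element `f` yields a split pair in the quotient by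
`f`. -/
theorem exists_splitPair {G ι : Type*} [AddCommGroup G] [Fintype G] [Fintype ι] {n : ℕ} (u : ι → G)
    (ν : ι ≃ ι) (hν : ∀ i, u (ν i) = - u i) (i₀ : ι) (hi₀ : u i₀ = 0)
    (hι : Fintype.card ι = 2 * n + 1) (hG : Fintype.card G = 2 * (n ^ 2 + n + 1)) {f : G}
    (hf : f ≠ 0) (hff : 2 • f = 0)
    (hR : (∑ i, mono (u i)) ^ 2 + ∑ i, mono (2 • u i)
      = 2 * total G - 2 * mono f + 2 * (n : GroupRing G)) :
    ∃ (_ : Fintype (G ⧸ AddSubgroup.zmultiples f))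
      (p q : GroupRing (G ⧸ AddSubgroup.zmultiples f)), SplitPair n p q := by
  classical
  set m := n ^ 2 + n + 1 with hm
  have hmo : Odd m := by
    rcases Nat.even_or_odd n with ⟨k, hk⟩ | ⟨k, hk⟩
    · exact ⟨2 * k ^ 2 + k, by rw [hm, hk]; ring⟩
    · exact ⟨2 * k ^ 2 + 3 * k + 1, by rw [hm, hk]; ring⟩
  let K := AddSubgroup.zmultiples f
  let π : G →+ G ⧸ K := QuotientAddGroup.mk' K
  let : Fintype (G ⧸ K) := Fintype.ofFinite _
  have hπf : π f = 0 := (QuotientAddGroup.eq_zero_iff f).mpr (AddSubgroup.mem_zmultiples f)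
  have hπs : Function.Surjective π := QuotientAddGroup.mk'_surjective K
  have hK : Nat.card K = 2 := by
    rw [Nat.card_zmultiples]
    exact addOrderOf_eq_prime hff hf
  have hcard : Fintype.card (G ⧸ K) = m := by
    have h1 := AddSubgroup.card_eq_card_quotient_mul_card_addSubgroup K
    rw [hK, Nat.card_eq_fintype_card, hG, Nat.card_eq_fintype_card] at h1
    omega
  have htor : ∀ x : G ⧸ K, m • x = 0 := fun x => by rw [← hcard]; exact card_nsmul_eq_zero
  have htwo : ∀ g : G, m • g = 0 ∨ m • g = f := fun g => by
    refine eq_zero_or_eq_of_two_nsmul hff hmo htor ?_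
    rw [← mul_smul, ← hG]; exact card_nsmul_eq_zero
  let ε : G → ℤ := fun g => if m • g = 0 then 1 else -1
  have hε0 : ε 0 = 1 := by simp [ε]
  have hεf : ε f = -1 := by
    obtain ⟨k, hk⟩ := hmo
    simp only [ε]
    rw [if_neg]
    rwa [hk, add_smul, mul_comm, mul_smul, hff, smul_zero, zero_add, one_smul]
  have hεadd : ∀ g g', ε (g + g') = ε g * ε g' := fun g g' => by
    simp only [ε, smul_add]
    rcases htwo g with h1 | h1 <;> rcases htwo g' with h2 | h2 <;> rw [h1, h2]
    · simp
    · simp [hf]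
    · simp [hf]
    · rw [← two_nsmul, hff]; simp [hf]
  have hε2 : ∀ g, ε (2 • g) = 1 := fun g => by
    rw [two_nsmul, hεadd]; simp only [ε]; split_ifs <;> rfl
  let E : GroupRing G →+* GroupRing (G ⧸ K) :=
    (AddMonoidAlgebra.lift ℤ (GroupRing (G ⧸ K)) G
      { toFun := fun g => (ε g.toAdd : GroupRing (G ⧸ K)) * mono (π g.toAdd)
        map_one' := by simp [hε0, mono_zero]
        map_mul' := fun g g' => by
          rw [toAdd_mul, hεadd, map_add, ← mono_mul_mono]; push_cast; ring } :
      GroupRing G →ₐ[ℤ] GroupRing (G ⧸ K)).toRingHom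
  have hE : ∀ g, E (mono g) = (ε g : GroupRing (G ⧸ K)) * mono (π g) := fun g => by
    simp [E, mono]
  have hEtot : E (total G) = 0 := by
    have h1 := congrArg E (mono_mul_total f)
    rw [map_mul, hE, hεf, hπf, mono_zero] at h1
    refine intCast_mul_cancel (c := 2) (by norm_num) ?_
    push_cast at h1 ⊢
    linear_combination -h1
  have hPtot : push π (total G) = 2 * total (G ⧸ K) := by
    have h1 : push π (total G)
        = (((push π (total G)).coeff 0 : ℤ) : GroupRing (G ⧸ K)) * total (G ⧸ K) := by
      ext x
      obtain ⟨t, rfl⟩ := hπs x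
      rw [coeff_push_total, coeff_int_mul, coeff_total, mul_one]
    have h2 : aug (push π (total G)) = 2 * m := by
      have : aug (push π (total G)) = aug (total G) :=
        ringHom_eq_of_mono (f := aug.comp (push π)) (f' := aug)
          (fun g => by simp [push_mono, aug_mono]) _
      rw [this, aug_total, hG]; push_cast; ring
    rw [h1, map_mul, map_intCast, aug_total, hcard] at h2
    have h3 : (push π (total G)).coeff 0 = 2 :=
      mul_right_cancel₀ (by rw [hm]; positivity : (m : ℤ) ≠ 0) h2
    rw [h1, h3]; norm_num
  let S : Finset ι := {i | m • u i = 0}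
  let w : ι → G ⧸ K := fun i => π (u i)
  have hw : ∀ i, w (ν i) = - w i := fun i => by simp only [w, hν, map_neg]
  have hS : ∀ i, ν i ∈ S ↔ i ∈ S := fun i => by simp [S, hν]
  set a := ∑ i ∈ S, mono (w i) with ha
  set b := ∑ i ∈ Sᶜ, mono (w i) with hb
  have hPT : push π (∑ i, mono (u i)) = a + b := by
    rw [ha, hb, sum_add_sum_compl, map_sum]
    exact sum_congr rfl fun i _ => push_mono π _
  have hET : E (∑ i, mono (u i)) = a - b := by
    rw [← sum_add_sum_compl S, map_add, map_sum, map_sum, sub_eq_add_neg, ha, hb,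
      ← sum_neg_distrib]
    congr 1 <;> refine sum_congr rfl fun i hi => ?_
    · have h1 : ε (u i) = 1 := if_pos (by simpa [S] using hi)
      rw [hE, h1, Int.cast_one, one_mul]
    · have h1 : ε (u i) = -1 := if_neg (by simpa [S] using hi)
      rw [hE, h1]; simp [w]
  have hψ : ∑ i, mono (π (2 • u i)) = psi 2 (a + b) := by
    rw [← hPT, map_sum, map_sum]
    refine sum_congr rfl fun i _ => ?_
    rw [push_mono, psi_mono, map_nsmul, ← natCast_zsmul]; rfl
  have hPR := congrArg (push π) hR
  have hER := congrArg E hR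
  simp only [map_add, map_sub, map_mul, map_pow, hPT, hET, map_ofNat, map_natCast, hPtot, hEtot,
    push_mono, hE, hεf, hπf, mono_zero] at hPR hER
  rw [map_sum] at hPR hER
  simp only [push_mono, hE, hε2, Int.cast_one, one_mul] at hPR hER
  rw [hψ] at hPR hER
  have hmul : a * b = total (G ⧸ K) - 1 := by
    refine intCast_mul_cancel (c := 4) (by norm_num) ?_
    push_cast at hER ⊢
    linear_combination hPR - hER
  have hsq : a ^ 2 + b ^ 2 + psi 2 (a + b) = 2 * total (G ⧸ K) + 2 * (n : GroupRing (G ⧸ K)) := by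
    refine intCast_mul_cancel (c := 2) (by norm_num) ?_
    push_cast at hER ⊢
    linear_combination hPR + hER
  have hadd : aug a + aug b = 2 * n + 1 := by
    rw [← map_add, ha, hb, sum_add_sum_compl, map_sum]
    simp [aug_mono, hι]
  have haug : aug a * aug b = n ^ 2 + n := by
    rw [← map_mul, hmul, map_sub, map_one, aug_total, hcard, hm]; push_cast; ring
  have hsymm : psi (-1) a = a := psi_neg_sum_mono S w ν hw hS
  have hsymm' : psi (-1) b = b :=
    psi_neg_sum_mono Sᶜ w ν hw fun i => by rw [mem_compl, mem_compl, hS]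
  have hone : 1 ≤ (a + b).coeff 0 := by
    rw [ha, hb, sum_add_sum_compl, ← add_sum_erase _ _ (mem_univ i₀), AddMonoidAlgebra.coeff_add,
      Finsupp.add_apply, coeff_mono, if_pos (by simp only [w, hi₀, map_zero])]
    have := coeff_sum_mono_nonneg (univ.erase i₀) w 0
    omega
  have hcases : (aug a - n) * (aug a - (n + 1)) = 0 := by
    have h1 : aug b = 2 * n + 1 - aug a := by omega
    rw [h1] at haug; linear_combination -haug
  refine ⟨inferInstance, ?_⟩
  rcases mul_eq_zero.mp hcases with h1 | h1
  · exact ⟨a, b, hcard, hmul, hsq, by omega, by omega, coeff_sum_mono_nonneg _ _,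
      coeff_sum_mono_nonneg _ _, hsymm, hsymm', hone⟩
  · exact ⟨b, a, hcard, by rw [mul_comm, hmul], by rw [add_comm (b ^ 2), add_comm b, hsq],
      by omega, by omega, coeff_sum_mono_nonneg _ _,
      coeff_sum_mono_nonneg _ _, hsymm', hsymm, by rwa [add_comm b]⟩

end Reduction

section Sphere

variable {n : ℕ}

/-- The points of the Lee sphere of radius one. -/
def point : Option (Fin n × Bool) → Fin n → ℤ
  | none => 0
  | some (i, b) => Pi.single i (if b then 1 else -1)

/-- The inner product with a point of the Lee sphere of radius one. -/
def pairing : Option (Fin n × Bool) → (Fin n → ℤ) → ℤ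
  | none, _ => 0
  | some (i, b), x => (if b then 1 else -1) * x i

/-- The antipodal map on the index set of the Lee sphere of radius one. -/
def antipode : Option (Fin n × Bool) ≃ Option (Fin n × Bool) :=
  Equiv.optionCongr (Equiv.prodCongr (Equiv.refl _) Equiv.boolNot)

lemma point_antipode (s : Option (Fin n × Bool)) : point (antipode s) = - point s := by
  rcases s with _ | ⟨i, b⟩
  · simp [antipode, point]
  · cases b <;> simp [antipode, point, ← Pi.single_neg]

lemma pairing_add (s : Option (Fin n × Bool)) (x y : Fin n → ℤ) :
    pairing s (x + y) = pairing s x + pairing s y := by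
  rcases s with _ | ⟨i, b⟩ <;> simp [pairing, mul_add]

lemma pairing_self {s : Option (Fin n × Bool)} (hs : s ≠ none) : pairing s (point s) = 1 := by
  rcases s with _ | ⟨i, b⟩
  · exact absurd rfl hs
  · cases b <;> simp [pairing, point]

lemma eq_of_pairing_pos {s t : Option (Fin n × Bool)} (h : 0 < pairing s (point t)) : t = s := by
  rcases s with _ | ⟨i, b⟩ <;> rcases t with _ | ⟨j, c⟩
  · rfl
  · simp [pairing] at h
  · simp [pairing, point] at h
  · by_cases hij : i = j
    · subst hij; cases b <;> cases c <;> simp [pairing, point] at h ⊢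
    · simp [pairing, point, hij] at h

lemma add_eq_zero_of_pairing_neg {s t : Option (Fin n × Bool)} (h : pairing s (point t) < 0) :
    point s + point t = 0 := by
  rw [← neg_neg (point t), ← point_antipode t]
  have h1 : antipode t = s := by
    refine eq_of_pairing_pos ?_
    rw [point_antipode]
    have h2 := pairing_add s (point t) (-point t)
    have h3 : pairing s 0 = 0 := by rcases s with _ | ⟨i, b⟩ <;> simp [pairing]
    rw [add_neg_cancel, h3] at h2
    omega
  rw [h1, add_neg_cancel]

lemma point_injective : Function.Injective (point (n := n)) := by
  intro s t h
  by_cases hs : s = none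
  · by_cases ht : t = none
    · rw [hs, ht]
    · exact (eq_of_pairing_pos (by rw [h, pairing_self ht]; norm_num)).symm ▸ rfl
  · exact (eq_of_pairing_pos (by rw [← h, pairing_self hs]; norm_num)).symm

lemma sum_abs_point_le (s : Option (Fin n × Bool)) : ∑ i, |point s i| ≤ 1 := by
  rcases s with _ | ⟨i, b⟩
  · simp [point]
  · rw [sum_eq_single i (fun j _ hj => by simp [point, hj]) (by simp)]
    cases b <;> simp [point]

lemma point_add_point_mem (s t : Option (Fin n × Bool)) : point s + point t ∈ LeeSphere2 n := by
  have h1 : ∑ i, |(point s + point t) i| ≤ ∑ i, (|point s i| + |point t i|) :=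
    sum_le_sum fun i _ => abs_add_le _ _
  rw [sum_add_distrib] at h1
  have h2 := sum_abs_point_le s
  have h3 := sum_abs_point_le t
  exact h1.trans (by omega)

/-- A nonzero sum of two points determines the points up to order. -/
lemma eq_or_eq_of_point_add {s t s' t' : Option (Fin n × Bool)} (hz : point s + point t ≠ 0)
    (h : point s' + point t' = point s + point t) : s' = s ∧ t' = t ∨ s' = t ∧ t' = s := by
  wlog hs : s ≠ none generalizing s t
  · push Not at hs
    by_cases ht : t = none
    · subst hs ht; exact absurd (by simp [point]) hz
    · exact (this (by rwa [add_comm]) (by rw [h, add_comm]) ht).symm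
  have h1 : 0 ≤ pairing s (point t) := by
    by_contra! hc
    exact hz (add_eq_zero_of_pairing_neg hc)
  have h2 := congrArg (pairing s) h
  rw [pairing_add, pairing_add, pairing_self hs] at h2
  rcases lt_or_ge 0 (pairing s (point s')) with h3 | h3
  · have h4 := eq_of_pairing_pos h3
    subst h4
    exact Or.inl ⟨rfl, point_injective (add_left_cancel h)⟩
  · have h4 := eq_of_pairing_pos (s := s) (t := t') (by omega)
    subst h4
    rw [add_comm (point t')] at h
    exact Or.inr ⟨point_injective (add_right_cancel h), rfl⟩

variable {G : Type*} [AddCommGroup G]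

/-- The number of representations of group elements as sums of two points, the diagonal being
counted twice. -/
noncomputable def covering (φ : (Fin n → ℤ) →+ G) : GroupRing G :=
  (∑ s, mono (φ (point s))) ^ 2 + ∑ s, mono (2 • φ (point s))

lemma coeff_covering [DecidableEq G] (φ : (Fin n → ℤ) →+ G) (x : G) : (covering φ).coeff x =
    #{r : Option (Fin n × Bool) × Option (Fin n × Bool) | φ (point r.1 + point r.2) = x}
      + #{s : Option (Fin n × Bool) | φ (point s + point s) = x} := by
  rw [covering, pow_two, sum_mul_sum, ← sum_product', AddMonoidAlgebra.coeff_add,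
    Finsupp.add_apply, AddMonoidAlgebra.coeff_sum, Finsupp.finsetSum_apply,
    AddMonoidAlgebra.coeff_sum, Finsupp.finsetSum_apply]
  simp only [mono_mul_mono, coeff_mono, sum_boole, two_nsmul, map_add, univ_product_univ]

lemma aug_covering (φ : (Fin n → ℤ) →+ G) :
    aug (covering φ) = (2 * n + 1) ^ 2 + (2 * n + 1) := by
  simp only [covering, map_add, map_pow, map_sum, aug_mono, sum_const, card_univ]
  simp [mul_comm]

lemma coeff_covering_neg [Fintype G] (φ : (Fin n → ℤ) →+ G) (x : G) :
    (covering φ).coeff (-x) = (covering φ).coeff x := by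
  refine coeff_neg_of_psi ?_ x
  rw [covering, map_add, map_pow,
    psi_neg_sum_mono univ _ antipode (fun s => by rw [point_antipode, map_neg]) (by simp),
    psi_neg_sum_mono univ _ antipode (fun s => by rw [point_antipode, map_neg, smul_neg]) (by simp)]

variable {φ : (Fin n → ℤ) →+ G} (hφ : Set.InjOn φ (LeeSphere2 n))
include hφ

lemma coeff_covering_zero : (covering φ).coeff 0 = 2 * n + 2 := by
  classical
  have h0 : ∀ s t : Option (Fin n × Bool), φ (point s + point t) = 0 ↔ t = antipode s := by
    intro s t
    constructor
    · intro h
      have h1 : point s + point t = 0 :=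
        hφ (point_add_point_mem s t) (by simp [LeeSphere2]) (by rw [h, map_zero])
      apply point_injective
      rw [point_antipode, eq_neg_of_add_eq_zero_right h1]
    · rintro rfl
      rw [point_antipode, add_neg_cancel, map_zero]
  rw [coeff_covering]
  simp only [h0]
  have h1 : #{r : Option (Fin n × Bool) × Option (Fin n × Bool) | r.2 = antipode r.1}
      = 2 * n + 1 := by
    rw [card_bij' (t := (univ : Finset (Option (Fin n × Bool)))) (fun r _ => r.1)
      (fun s _ => (s, antipode s)) (by simp) (by simp) (by
        rintro ⟨s, t⟩ h; simp at h; simp [h]) (by simp)]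
    simp [mul_comm]
  have h2 : #{s : Option (Fin n × Bool) | s = antipode s} = 1 := by
    rw [card_eq_one]
    refine ⟨none, ?_⟩
    ext s
    rcases s with _ | ⟨i, b⟩
    · simp [antipode]
    · cases b <;> simp [antipode]
  rw [h1, h2]; push_cast; ring

lemma coeff_covering_eq_zero_or_two {x : G} (hx : x ≠ 0) :
    (covering φ).coeff x = 0 ∨ (covering φ).coeff x = 2 := by
  classical
  rw [coeff_covering]
  by_cases hne : ∃ s t : Option (Fin n × Bool), φ (point s + point t) = x
  · right
    obtain ⟨s, t, rfl⟩ := hne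
    have hz : point s + point t ≠ 0 := fun hz => hx (by rw [hz, map_zero])
    have key : ∀ s' t' : Option (Fin n × Bool), φ (point s' + point t') = φ (point s + point t) ↔
        s' = s ∧ t' = t ∨ s' = t ∧ t' = s := fun s' t' => by
      refine ⟨fun h => eq_or_eq_of_point_add hz
        (hφ (point_add_point_mem s' t') (point_add_point_mem s t) h), ?_⟩
      rintro (⟨rfl, rfl⟩ | ⟨rfl, rfl⟩)
      · rfl
      · rw [add_comm]
    simp only [key]
    by_cases hst : s = t
    · subst hst
      have h1 : ({r | r.1 = s ∧ r.2 = s ∨ r.1 = s ∧ r.2 = s} :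
          Finset (Option (Fin n × Bool) × Option (Fin n × Bool))) = {(s, s)} := by
        ext ⟨a, b⟩; simp
      have h2 : ({a | a = s ∧ a = s ∨ a = s ∧ a = s} : Finset (Option (Fin n × Bool))) = {s} := by
        ext a; simp
      rw [h1, h2]; simp
    · have h1 : ({r | r.1 = s ∧ r.2 = t ∨ r.1 = t ∧ r.2 = s} :
          Finset (Option (Fin n × Bool) × Option (Fin n × Bool))) = {(s, t), (t, s)} := by
        ext ⟨a, b⟩; simp
      have h2 : ({a | a = s ∧ a = t ∨ a = t ∧ a = s} : Finset (Option (Fin n × Bool))) = ∅ := by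
        ext a; simp; grind
      rw [h1, h2, card_pair (by simp [hst])]; simp
  · left
    push Not at hne
    rw [filter_false_of_mem fun r _ => hne r.1 r.2, filter_false_of_mem fun r _ => hne r r]
    simp

/-- Exactly one element of the quotient is not covered by the Lee sphere. -/
lemma exists_covering_eq [Fintype G] (hG : Fintype.card G = 2 * (n ^ 2 + n + 1)) :
    ∃ f : G, f ≠ 0 ∧ 2 • f = 0 ∧
      covering φ = 2 * total G - 2 * mono f + 2 * (n : GroupRing G) := by
  classical
  let F : Finset G := {x | x ≠ 0 ∧ (covering φ).coeff x = 0}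
  have hF : ∀ x, x ∈ F ↔ x ≠ 0 ∧ (covering φ).coeff x = 0 := fun x => by simp [F]
  have hc : ∀ x, (covering φ).coeff x
      = 2 - 2 * (if x ∈ F then 1 else 0) + 2 * n * (if x = 0 then 1 else 0) := by
    intro x
    by_cases hx : x = 0
    · subst hx
      rw [coeff_covering_zero hφ, if_neg (by simp [hF]), if_pos rfl]; ring
    · rw [if_neg hx]
      rcases coeff_covering_eq_zero_or_two hφ hx with h1 | h1
      · rw [h1, if_pos ((hF x).mpr ⟨hx, h1⟩)]; ring
      · rw [h1, if_neg (by simp [hF, h1])]; ring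
  have hcard : #F = 1 := by
    have h1 := aug_covering φ
    rw [aug_eq_sum] at h1
    simp only [hc, sum_add_distrib, sum_sub_distrib, ← mul_sum, sum_ite_mem, sum_ite_eq', sum_const,
      card_univ, hG, univ_inter, mem_univ, if_true] at h1
    simp only [nsmul_eq_mul] at h1
    push_cast at h1
    have h2 : (#F : ℤ) = 1 := by linarith
    exact_mod_cast h2
  obtain ⟨f, hf⟩ := card_eq_one.mp hcard
  have hfm := (hF f).mp (by rw [hf]; exact mem_singleton_self f)
  refine ⟨f, hfm.1, ?_, ?_⟩
  · have h1 : -f ∈ F := (hF _).mpr ⟨neg_ne_zero.mpr hfm.1, by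
      rw [coeff_covering_neg φ, hfm.2]⟩
    rw [hf, mem_singleton] at h1
    rw [two_nsmul]; nth_rw 1 [← h1]; exact neg_add_cancel f
  · have h1 : 2 * total G - 2 * mono f + 2 * (n : GroupRing G) = ((2 : ℕ) : GroupRing G) * total G
        - ((2 : ℕ) : GroupRing G) * mono f + ((2 * n : ℕ) : GroupRing G) * mono 0 := by
      rw [mono_zero]; push_cast; ring
    rw [h1]
    ext x
    rw [hc, hf]
    simp only [AddMonoidAlgebra.coeff_add, AddMonoidAlgebra.coeff_sub, Finsupp.add_apply,
      Finsupp.sub_apply, coeff_nat_mul, coeff_mono, coeff_total, mem_singleton, eq_comm (a := x)]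
    push_cast; ring

end Sphere

/-- The quotient map of a code is injective on the Lee sphere. -/
lemma injOn_leeSphere2 {n : ℕ} {C : AddSubgroup (Fin n → ℤ)} (h : IsAPLLCode n C) :
    Set.InjOn (QuotientAddGroup.mk' C) (LeeSphere2 n) := by
  intro x hx y hy hxy
  by_contra hne
  have h1 : -x + y ∈ C := QuotientAddGroup.eq.mp hxy
  refine Set.disjoint_left.mp (h.2 _ h1 0 C.zero_mem ?_) ⟨x, hx, rfl⟩ ⟨y, hy, by simp⟩
  intro h2
  exact hne (neg_add_eq_zero.mp h2)

end APLL

/-- There is no almost perfect linear Lee code of packing radius 2 in `ℤⁿ` for any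
positive integer `n ∉ {1, 2, 11, 29, 47, 56, 67, 79, 104, 121, 134, 191}`. -/
theorem no_APLL_code_of_packing_radius_two (n : ℕ) (hn : 0 < n)
    (hexc : n ∉ ({1, 2, 11, 29, 47, 56, 67, 79, 104, 121, 134, 191} : Set ℕ)) :
    ¬ ∃ C : AddSubgroup (Fin n → ℤ), IsAPLLCode n C := by
  rintro ⟨C, hC⟩
  have hfin : C.FiniteIndex := ⟨by rw [hC.1]; positivity⟩
  let : Fintype ((Fin n → ℤ) ⧸ C) := Fintype.ofFinite _
  have hG : Fintype.card ((Fin n → ℤ) ⧸ C) = 2 * (n ^ 2 + n + 1) := by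
    rw [← Nat.card_eq_fintype_card]
    exact hC.1.trans (by ring)
  obtain ⟨f, hf, hff, hR⟩ := APLL.exists_covering_eq (APLL.injOn_leeSphere2 hC) hG
  obtain ⟨_, p, q, h⟩ := APLL.exists_splitPair
    (fun s => QuotientAddGroup.mk' C (APLL.point s)) APLL.antipode
    (fun s => by rw [APLL.point_antipode, map_neg]) none (map_zero _)
    (by simp [mul_comm]) hG hf hff hR
  exact APLL.SplitPair.not_of_not_mem hn hexc h
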